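/- arXiv:1006.3883 — 2 statements merged into one kernel-verified Lean document; each statement's English description precedes it below -/
import Mathlib

section
/- The total number of facets of Δ_{LT(J)} equals the sum over (i,j) with 1 ≤ i ≤ m, 1 ≤ j ≤ n, (i,j) ≠ (m,n) of C(m+n-i-j, m-i) times det[[C(i+n-2,i-1), C(m+j-2,m-1)], [C(i+n-3,i-2), C(m+j-3,m-2)]], and this number equals C(m+n-2, m-1)². -/
/-- Vertices of the complex: `(true, i, j)` is `x_{i,j}`, `(false, i, j)` is `y_{i,j}`. -/
abbrev V : Type := Bool × ℕ × ℕ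

def InGrid (m n : ℕ) (v : V) : Prop :=
  1 ≤ v.2.1 ∧ v.2.1 ≤ m ∧ 1 ≤ v.2.2 ∧ v.2.2 ≤ n

/-- A face of `Δ_{LT(J)}`: a set of vertices in the grid whose squarefree monomial
is divisible by no element of the families A, B, C, D, E. -/
def IsFace (m n : ℕ) (F : Finset V) : Prop :=
  (∀ v ∈ F, InGrid m n v) ∧
  (∀ i j k l : ℕ, i < j → k < l → ¬((true, i, l) ∈ F ∧ (true, j, k) ∈ F)) ∧
  (∀ i j k l : ℕ, i < j → k < l → ¬((true, i, k) ∈ F ∧ (false, j, l) ∈ F)) ∧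
  (∀ i j k p q r : ℕ, i < j → j ≤ k → p < q → q < r →
      ¬((true, k, p) ∈ F ∧ (false, j, q) ∈ F ∧ (false, i, r) ∈ F)) ∧
  (∀ i j k p q r : ℕ, i < j → j < k → p < q → q ≤ r →
      ¬((true, i, r) ∈ F ∧ (false, j, q) ∈ F ∧ (false, k, p) ∈ F)) ∧
  (∀ i j k p q r : ℕ, i < j → j < k → p < q → q < r →
      ¬((false, i, r) ∈ F ∧ (false, j, q) ∈ F ∧ (false, k, p) ∈ F))

/-- A facet: an inclusion-maximal face. -/
def IsFacet (m n : ℕ) (F : Finset V) : Prop :=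
  IsFace m n F ∧ ∀ G : Finset V, IsFace m n G → F ⊆ G → F = G

/-- Binomial coefficient on integers, zero when `b < 0` or `b > a`. -/
def binom (a b : ℤ) : ℤ := if 0 ≤ b ∧ b ≤ a then (a.toNat.choose b.toNat : ℤ) else 0

/-- The number of monotone lattice paths from `(1, 1)` to `(a, b)`. -/
def pathCount (a b : ℕ) : ℤ :=
  if a = 0 ∨ b = 0 then 0 else ((a + b - 2).choose (a - 1) : ℤ)

lemma pathCount_zero_left (b : ℕ) : pathCount 0 b = 0 := by simp [pathCount]

lemma pathCount_zero_right (a : ℕ) : pathCount a 0 = 0 := by simp [pathCount]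

lemma pathCount_one_left (b : ℕ) (hb : 1 ≤ b) : pathCount 1 b = 1 := by
  simp [pathCount]; omega

lemma pathCount_one_right (a : ℕ) (ha : 1 ≤ a) : pathCount a 1 = 1 := by
  obtain ⟨a, rfl⟩ := Nat.exists_eq_add_of_le' ha
  simp [pathCount]

lemma pathCount_rec (a b : ℕ) (ha : 1 ≤ a) (hb : 1 ≤ b) (h : 3 ≤ a + b) :
    pathCount a b = pathCount (a - 1) b + pathCount a (b - 1) := by
  obtain ⟨a, rfl⟩ := Nat.exists_eq_add_of_le' ha
  obtain ⟨b, rfl⟩ := Nat.exists_eq_add_of_le' hb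
  simp only [Nat.add_sub_cancel]
  rcases a with _ | a
  · rw [pathCount_zero_left, pathCount_one_left _ (by omega), pathCount_one_left _ (by omega)]
    rfl
  rcases b with _ | b
  · rw [pathCount_zero_right, pathCount_one_right _ (by omega), pathCount_one_right _ (by omega)]
    rfl
  have e1 : a + 1 + 1 + (b + 1 + 1) - 2 = (a + b + 1) + 1 := by omega
  have e2 : a + 1 + (b + 1 + 1) - 2 = a + b + 1 := by omega
  have e3 : a + 1 + 1 + (b + 1) - 2 = a + b + 1 := by omega
  simp [pathCount, e1, e2, e3, Nat.choose_succ_succ]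

lemma binom_eq_pathCount (a b : ℕ) (x y : ℤ) (hx : x = (a : ℤ) + b - 2) (hy : y = (a : ℤ) - 1)
    (hb : 1 ≤ b) : binom x y = pathCount a b := by
  subst hx hy
  unfold binom pathCount
  by_cases ha : a = 0
  · subst ha; simp
  · rw [if_pos (by omega), if_neg (by omega)]
    congr 2 <;> omega

/-- The determinant counting pairs of non-intersecting monotone lattice paths
from `(1, 1)` to `(a, b)` and from `(2, 1)` to `(c, d)`. -/
def pairCount (a b c d : ℕ) : ℤ :=
  pathCount a b * pathCount (c - 1) d - pathCount c d * pathCount (a - 1) b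

/-- No element of `Y` lies strictly north-east of another one. -/
def IsNWChain (Y : Finset (ℕ × ℕ)) : Prop :=
  ∀ s t s' t', (s, t) ∈ Y → (s', t') ∈ Y → s < s' → t' < t → False

/-- The condition on `Y` for being covered by two chains with greatest elements
`(a, b)` and `(c, d)`. -/
structure IsTwoChain (a b c d : ℕ) (Y : Finset (ℕ × ℕ)) : Prop where
  pos : ∀ s t, (s, t) ∈ Y → 1 ≤ s ∧ 1 ≤ t
  cover : ∀ s t, (s, t) ∈ Y → (s ≤ a ∧ t ≤ b) ∨ (s ≤ c ∧ t ≤ d)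
  left : ∀ s t s' t', (s, t) ∈ Y → (s', t') ∈ Y → s < s' → t' < t →
    (s ≤ a ∧ t ≤ b) ∨ (s' ≤ a ∧ t' ≤ b)
  right : ∀ s t s' t', (s, t) ∈ Y → (s', t') ∈ Y → s < s' → t' < t →
    (s ≤ c ∧ t ≤ d) ∨ (s' ≤ c ∧ t' ≤ d)
  noTriple : ∀ s t s' t' s'' t'', (s, t) ∈ Y → (s', t') ∈ Y → (s'', t'') ∈ Y →
    s < s' → t' < t → s' < s'' → t'' < t' → False

/-- `(a, b)` and `(c, d)` are distinct, the first weakly north-east of the second, and they can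
be joined to `(1, 1)` and `(2, 1)` by non-intersecting paths. -/
def EndPair (a b c d : ℕ) : Prop :=
  1 ≤ a ∧ a ≤ c ∧ 1 ≤ d ∧ d ≤ b ∧ 2 ≤ c ∧ ¬(a = c ∧ b = d) ∧ ((a = 1 ∧ b = 1) ∨ 2 ≤ b)

lemma IsTwoChain.swap {a b c d : ℕ} {Y : Finset (ℕ × ℕ)} (h : IsTwoChain a b c d Y) :
    IsTwoChain c d a b Y :=
  ⟨h.pos, fun s t hs => (h.cover s t hs).symm, h.right, h.left, h.noTriple⟩

lemma IsTwoChain.insert {a b a' b' c d : ℕ} {Y : Finset (ℕ × ℕ)} (h : IsTwoChain a' b' c d Y)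
    (ha : a' ≤ a) (hb : b' ≤ b) (ha1 : 1 ≤ a) (hb1 : 1 ≤ b) :
    IsTwoChain a b c d (insert (a, b) Y) := by
  obtain ⟨h1, h2, h3, h4, h5⟩ := h
  refine ⟨?_, ?_, ?_, ?_, ?_⟩ <;> simp only [Finset.mem_insert, Prod.mk.injEq]
  · grind
  · grind
  · grind
  · grind
  · intro s t s' t' s'' t'' hs hs' hs'' l1 l2 l3 l4
    rcases hs with ⟨rfl, rfl⟩ | hs
    · have := h3 s' t' s'' t''
      grind
    rcases hs' with ⟨rfl, rfl⟩ | hs'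
    · have := h3 s t s'' t''
      grind
    rcases hs'' with ⟨rfl, rfl⟩ | hs''
    · have := h3 s t s' t'
      grind
    exact h5 s t s' t' s'' t'' hs hs' hs'' l1 l2 l3 l4

lemma IsTwoChain.erase_left {a b c d : ℕ} {Y : Finset (ℕ × ℕ)} (h : IsTwoChain a b c d Y)
    (hE : EndPair a b c d) (hle : c + d ≤ a + b) :
    (EndPair (a - 1) b c d ∧ IsTwoChain (a - 1) b c d (Y.erase (a, b))) ∨
      (EndPair a (b - 1) c d ∧ IsTwoChain a (b - 1) c d (Y.erase (a, b))) := by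
  obtain ⟨h1, h2, h3, h4, h5⟩ := h
  unfold EndPair at *
  by_cases hf : a = 1 ∨ ∃ t, (a, t) ∈ Y ∧ t < b ∧ (d < t ∨ ∃ s u, (s, u) ∈ Y ∧ a < s ∧ u < t)
  · right
    have hcol : ∀ s, (s, b) ∈ Y → s < a → False := by
      intro s hs hsa
      rcases hf with rfl | ⟨t, ht, htb, hf⟩
      · have := h1 _ _ hs
        omega
      rcases hf with hf | ⟨s', u, hu, l1, l2⟩
      · have := h4 _ _ _ _ hs ht hsa htb
        omega
      · exact h5 _ _ _ _ _ _ hs ht hu hsa htb l1 l2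
    refine ⟨?_, ?_⟩
    · rcases hf with rfl | ⟨t, ht, htb, hf⟩
      · omega
      · have := h1 _ _ ht
        rcases hf with hf | ⟨s', u, hu, l1, l2⟩
        · omega
        · have := h1 _ _ hu
          have := h2 _ _ hu
          omega
    · refine ⟨?_, ?_, ?_, ?_, ?_⟩ <;> simp only [Finset.mem_erase, ne_eq, Prod.mk.injEq]
      · grind
      · intro s t hs
        have := h2 s t hs.2
        have := hcol s
        grind
      · intro s t s' t' hs hs' l1 l2
        have := h3 s t s' t' hs.2 hs'.2 l1 l2
        have := hcol s
        have := hcol s'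
        grind
      · grind
      · grind
  · left
    push Not at hf
    obtain ⟨ha, hf⟩ := hf
    refine ⟨by omega, ?_⟩
    refine ⟨?_, ?_, ?_, ?_, ?_⟩ <;> simp only [Finset.mem_erase, ne_eq, Prod.mk.injEq]
    · grind
    · intro s t hs
      have := h2 s t hs.2
      have := hf t
      grind
    · intro s t s' t' hs hs' l1 l2
      have := h3 s t s' t' hs.2 hs'.2 l1 l2
      have := hf t
      have := hf t'
      grind
    · grind
    · grind

lemma IsTwoChain.erase_right {a b c d : ℕ} {Y : Finset (ℕ × ℕ)} (h : IsTwoChain a b c d Y)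
    (hE : EndPair a b c d) (hlt : a + b < c + d) (hbase : 4 ≤ c + d) :
    (EndPair a b (c - 1) d ∧ IsTwoChain a b (c - 1) d (Y.erase (c, d))) ∨
      (EndPair a b c (d - 1) ∧ IsTwoChain a b c (d - 1) (Y.erase (c, d))) := by
  obtain ⟨h1, h2, h3, h4, h5⟩ := h
  unfold EndPair at *
  by_cases hf : d = 1 ∨ ∃ s, (s, d) ∈ Y ∧ s < c ∧ (a < s ∨ ∃ u v, (u, v) ∈ Y ∧ u < s ∧ d < v)
  · left
    have hrow : ∀ t, (c, t) ∈ Y → t < d → False := by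
      intro t ht htd
      rcases hf with rfl | ⟨s, hs, hsc, hf⟩
      · have := h1 _ _ ht
        omega
      rcases hf with hf | ⟨u, v, hu, l1, l2⟩
      · have := h3 _ _ _ _ hs ht hsc htd
        omega
      · exact h5 _ _ _ _ _ _ hu hs ht l1 l2 hsc htd
    refine ⟨?_, ?_⟩
    · rcases hf with rfl | ⟨s, hs, hsc, hf⟩
      · omega
      · have := h1 _ _ hs
        rcases hf with hf | ⟨u, v, hu, l1, l2⟩
        · omega
        · have := h1 _ _ hu
          have := h2 _ _ hu
          omega
    · refine ⟨?_, ?_, ?_, ?_, ?_⟩ <;> simp only [Finset.mem_erase, ne_eq, Prod.mk.injEq]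
      · grind
      · intro s t hs
        have := h2 s t hs.2
        have := hrow t
        grind
      · grind
      · intro s t s' t' hs hs' l1 l2
        have := h4 s t s' t' hs.2 hs'.2 l1 l2
        have := hrow t
        have := hrow t'
        grind
      · grind
  · right
    push Not at hf
    obtain ⟨ha, hf⟩ := hf
    refine ⟨by omega, ?_⟩
    refine ⟨?_, ?_, ?_, ?_, ?_⟩ <;> simp only [Finset.mem_erase, ne_eq, Prod.mk.injEq]
    · grind
    · intro s t hs
      have := h2 s t hs.2
      have := hf s
      grind
    · grind
    · intro s t s' t' hs hs' l1 l2
      have := h4 s t s' t' hs.2 hs'.2 l1 l2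
      have := hf s
      have := hf s'
      grind
    · grind

/-- `S` is the family of unions of non-intersecting path pairs ending at `(a, b)` and `(c, d)`. -/
structure IsPairFamily (a b c d : ℕ) (S : Finset (Finset (ℕ × ℕ))) : Prop where
  twoChain : ∀ Y ∈ S, IsTwoChain a b c d Y
  endPair : ∀ Y ∈ S, EndPair a b c d
  mem_left : ∀ Y ∈ S, (a, b) ∈ Y
  mem_right : ∀ Y ∈ S, (c, d) ∈ Y
  card_mem : ∀ Y ∈ S, Y.card + 3 = a + b + c + d
  complete : EndPair a b c d → ∀ Y, IsTwoChain a b c d Y → ∃ Z ∈ S, Y ⊆ Z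
  card_eq : (S.card : ℤ) = pairCount a b c d

lemma isPairFamily_empty {a b c d : ℕ} (h : ¬ EndPair a b c d) (h0 : pairCount a b c d = 0) :
    IsPairFamily a b c d ∅ :=
  ⟨by simp, by simp, by simp, by simp, by simp, fun h' => absurd h' h, by simp [h0]⟩

lemma card_union_image_insert {S T : Finset (Finset (ℕ × ℕ))} {p : ℕ × ℕ}
    (hS : ∀ Y ∈ S, p ∉ Y) (hT : ∀ Y ∈ T, p ∉ Y) (hST : Disjoint S T) :
    ((S ∪ T).image (insert p)).card = S.card + T.card := by
  rw [Finset.card_image_of_injOn, Finset.card_union_of_disjoint hST]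
  intro Y hY Z hZ hYZ
  have hY' : p ∉ Y := by
    rcases Finset.mem_union.1 (Finset.mem_coe.1 hY) with h | h
    exacts [hS _ h, hT _ h]
  have hZ' : p ∉ Z := by
    rcases Finset.mem_union.1 (Finset.mem_coe.1 hZ) with h | h
    exacts [hS _ h, hT _ h]
  rw [← Finset.erase_insert hY', ← Finset.erase_insert hZ']
  exact congrArg (fun W => W.erase p) hYZ

lemma IsPairFamily.step_left {a b c d : ℕ} (hE : EndPair a b c d) (hle : c + d ≤ a + b)
    {S T : Finset (Finset (ℕ × ℕ))} (hS : IsPairFamily (a - 1) b c d S)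
    (hT : IsPairFamily a (b - 1) c d T) :
    IsPairFamily a b c d ((S ∪ T).image (insert (a, b))) := by
  have hS0 : ∀ Y ∈ S, (a, b) ∉ Y := by
    intro Y hY hm
    have := (hS.twoChain Y hY).cover _ _ hm
    unfold EndPair at hE
    omega
  have hT0 : ∀ Y ∈ T, (a, b) ∉ Y := by
    intro Y hY hm
    have := (hT.twoChain Y hY).cover _ _ hm
    unfold EndPair at hE
    omega
  have hST : Disjoint S T := by
    rw [Finset.disjoint_left]
    intro Y hY hY'
    have h1 := hS.mem_left Y hY
    have h2 := hT.mem_left Y hY'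
    have h3 := hS.mem_right Y hY
    have h4 := (hS.twoChain Y hY).cover _ _ h2
    have h5 := (hT.twoChain Y hY').left _ _ _ _ h1 h3
    have h6 := hS.endPair Y hY
    have h7 := hT.endPair Y hY'
    unfold EndPair at *
    omega
  refine ⟨?_, fun _ _ => hE, ?_, ?_, ?_, ?_, ?_⟩
  · intro Y hY
    simp only [Finset.mem_image, Finset.mem_union] at hY
    obtain ⟨Z, hZ | hZ, rfl⟩ := hY
    · exact (hS.twoChain Z hZ).insert (by omega) le_rfl hE.1 (by unfold EndPair at hE; omega)
    · exact (hT.twoChain Z hZ).insert le_rfl (by omega) hE.1 (by unfold EndPair at hE; omega)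
  · intro Y hY
    simp only [Finset.mem_image, Finset.mem_union] at hY
    obtain ⟨Z, -, rfl⟩ := hY
    exact Finset.mem_insert_self _ _
  · intro Y hY
    simp only [Finset.mem_image, Finset.mem_union] at hY
    obtain ⟨Z, hZ | hZ, rfl⟩ := hY
    · exact Finset.mem_insert_of_mem (hS.mem_right Z hZ)
    · exact Finset.mem_insert_of_mem (hT.mem_right Z hZ)
  · intro Y hY
    simp only [Finset.mem_image, Finset.mem_union] at hY
    obtain ⟨Z, hZ | hZ, rfl⟩ := hY
    · rw [Finset.card_insert_of_notMem (hS0 Z hZ)]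
      have := hS.card_mem Z hZ
      have := hS.endPair Z hZ
      unfold EndPair at *
      omega
    · rw [Finset.card_insert_of_notMem (hT0 Z hZ)]
      have := hT.card_mem Z hZ
      have := hT.endPair Z hZ
      unfold EndPair at *
      omega
  · intro _ Y hY
    rcases hY.erase_left hE hle with ⟨hE', hY'⟩ | ⟨hE', hY'⟩
    · obtain ⟨Z, hZ, hsub⟩ := hS.complete hE' _ hY'
      exact ⟨insert (a, b) Z, Finset.mem_image_of_mem _ (Finset.mem_union_left _ hZ),
        Finset.subset_insert_iff.2 hsub⟩
    · obtain ⟨Z, hZ, hsub⟩ := hT.complete hE' _ hY'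
      exact ⟨insert (a, b) Z, Finset.mem_image_of_mem _ (Finset.mem_union_right _ hZ),
        Finset.subset_insert_iff.2 hsub⟩
  · rw [card_union_image_insert hS0 hT0 hST]
    push_cast
    rw [hS.card_eq, hT.card_eq]
    unfold EndPair at hE
    unfold pairCount
    rw [pathCount_rec a b (by omega) (by omega) (by omega)]
    rcases Nat.lt_or_ge a 2 with h | h
    · obtain rfl : a = 1 := by omega
      simp [pathCount_zero_left]
    · rw [pathCount_rec (a - 1) b (by omega) (by omega) (by omega)]
      ring

lemma IsPairFamily.step_right {a b c d : ℕ} (hE : EndPair a b c d) (hlt : a + b < c + d)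
    (hbase : 4 ≤ c + d)
    {S T : Finset (Finset (ℕ × ℕ))} (hS : IsPairFamily a b (c - 1) d S)
    (hT : IsPairFamily a b c (d - 1) T) :
    IsPairFamily a b c d ((S ∪ T).image (insert (c, d))) := by
  have hS0 : ∀ Y ∈ S, (c, d) ∉ Y := by
    intro Y hY hm
    have := (hS.twoChain Y hY).cover _ _ hm
    unfold EndPair at hE
    omega
  have hT0 : ∀ Y ∈ T, (c, d) ∉ Y := by
    intro Y hY hm
    have := (hT.twoChain Y hY).cover _ _ hm
    unfold EndPair at hE
    omega
  have hST : Disjoint S T := by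
    rw [Finset.disjoint_left]
    intro Y hY hY'
    have h2 := hT.mem_right Y hY'
    have h4 := (hS.twoChain Y hY).cover _ _ h2
    have h6 := hS.endPair Y hY
    unfold EndPair at *
    omega
  refine ⟨?_, fun _ _ => hE, ?_, ?_, ?_, ?_, ?_⟩
  · intro Y hY
    simp only [Finset.mem_image, Finset.mem_union] at hY
    obtain ⟨Z, hZ | hZ, rfl⟩ := hY
    · exact ((hS.twoChain Z hZ).swap.insert (by omega) le_rfl
        (by unfold EndPair at hE; omega) hE.2.2.1).swap
    · exact ((hT.twoChain Z hZ).swap.insert le_rfl (by omega)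
        (by unfold EndPair at hE; omega) hE.2.2.1).swap
  · intro Y hY
    simp only [Finset.mem_image, Finset.mem_union] at hY
    obtain ⟨Z, hZ | hZ, rfl⟩ := hY
    · exact Finset.mem_insert_of_mem (hS.mem_left Z hZ)
    · exact Finset.mem_insert_of_mem (hT.mem_left Z hZ)
  · intro Y hY
    simp only [Finset.mem_image, Finset.mem_union] at hY
    obtain ⟨Z, -, rfl⟩ := hY
    exact Finset.mem_insert_self _ _
  · intro Y hY
    simp only [Finset.mem_image, Finset.mem_union] at hY
    obtain ⟨Z, hZ | hZ, rfl⟩ := hY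
    · rw [Finset.card_insert_of_notMem (hS0 Z hZ)]
      have := hS.card_mem Z hZ
      have := hS.endPair Z hZ
      unfold EndPair at *
      omega
    · rw [Finset.card_insert_of_notMem (hT0 Z hZ)]
      have := hT.card_mem Z hZ
      have := hT.endPair Z hZ
      unfold EndPair at *
      omega
  · intro _ Y hY
    rcases hY.erase_right hE hlt hbase with ⟨hE', hY'⟩ | ⟨hE', hY'⟩
    · obtain ⟨Z, hZ, hsub⟩ := hS.complete hE' _ hY'
      exact ⟨insert (c, d) Z, Finset.mem_image_of_mem _ (Finset.mem_union_left _ hZ),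
        Finset.subset_insert_iff.2 hsub⟩
    · obtain ⟨Z, hZ, hsub⟩ := hT.complete hE' _ hY'
      exact ⟨insert (c, d) Z, Finset.mem_image_of_mem _ (Finset.mem_union_right _ hZ),
        Finset.subset_insert_iff.2 hsub⟩
  · rw [card_union_image_insert hS0 hT0 hST]
    push_cast
    rw [hS.card_eq, hT.card_eq]
    unfold EndPair at hE
    unfold pairCount
    rw [pathCount_rec c d (by omega) (by omega) (by omega),
      pathCount_rec (c - 1) d (by omega) (by omega) (by omega)]
    ring

lemma isPairFamily_base : IsPairFamily 1 1 2 1 {{(1, 1), (2, 1)}} := by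
  refine ⟨?_, ?_, ?_, ?_, ?_, ?_, ?_⟩
  · intro Y hY
    obtain rfl := Finset.mem_singleton.1 hY
    refine ⟨?_, ?_, ?_, ?_, ?_⟩ <;>
      simp only [Finset.mem_insert, Finset.mem_singleton, Prod.mk.injEq] <;> omega
  · intro Y hY
    unfold EndPair
    omega
  · intro Y hY
    obtain rfl := Finset.mem_singleton.1 hY
    simp
  · intro Y hY
    obtain rfl := Finset.mem_singleton.1 hY
    simp
  · intro Y hY
    obtain rfl := Finset.mem_singleton.1 hY
    rfl
  · intro _ Y hY
    refine ⟨_, Finset.mem_singleton_self _, ?_⟩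
    rintro ⟨s, t⟩ hs
    have := hY.pos _ _ hs
    have := hY.cover _ _ hs
    simp only [Finset.mem_insert, Finset.mem_singleton, Prod.mk.injEq]
    omega
  · simp [pairCount, pathCount]

lemma exists_isPairFamily : ∀ N a b c d : ℕ, a + b + c + d = N → EndPair a b c d →
    ∃ S, IsPairFamily a b c d S := by
  intro N
  induction N using Nat.strong_induction_on with
  | _ N ih =>
  intro a b c d hN hE
  have key : ∀ a' b' c' d', a' + b' + c' + d' < N →
      (¬ EndPair a' b' c' d' → pairCount a' b' c' d' = 0) →
      ∃ S, IsPairFamily a' b' c' d' S := by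
    intro a' b' c' d' hlt h0
    by_cases h : EndPair a' b' c' d'
    · exact ih _ hlt a' b' c' d' rfl h
    · exact ⟨∅, isPairFamily_empty h (h0 h)⟩
  have hE' := hE
  obtain ⟨h1, h2, h3, h4, h5, h6, h7⟩ := hE'
  rcases Nat.lt_or_ge (a + b) (c + d) with hlt | hle
  · rcases Nat.lt_or_ge (c + d) 4 with hb | hb
    · obtain ⟨rfl, rfl, rfl, rfl⟩ : a = 1 ∧ b = 1 ∧ c = 2 ∧ d = 1 := by omega
      exact ⟨_, isPairFamily_base⟩
    · obtain ⟨S, hS⟩ := key a b (c - 1) d (by omega) (by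
        intro h
        obtain ⟨rfl, rfl⟩ : a = c - 1 ∧ b = d := by unfold EndPair at h; omega
        simp [pairCount])
      obtain ⟨T, hT⟩ := key a b c (d - 1) (by omega) (by
        intro h
        obtain rfl : d = 1 := by unfold EndPair at h; omega
        simp [pairCount, pathCount_zero_right])
      exact ⟨_, IsPairFamily.step_right hE hlt hb hS hT⟩
  · obtain ⟨S, hS⟩ := key (a - 1) b c d (by omega) (by
      intro h
      obtain rfl : a = 1 := by unfold EndPair at h; omega
      simp [pairCount, pathCount_zero_left])
    obtain ⟨T, hT⟩ := key a (b - 1) c d (by omega) (by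
      intro h
      have : (a = c ∧ b - 1 = d) ∨ (2 ≤ a ∧ b = 2 ∧ d = 1) := by unfold EndPair at h; omega
      rcases this with ⟨rfl, rfl⟩ | ⟨ha, rfl, rfl⟩
      · simp [pairCount]
      · unfold pairCount
        rw [pathCount_one_right _ (by omega), pathCount_one_right _ (by omega),
          pathCount_one_right _ (by omega), pathCount_one_right _ (by omega)]
        rfl)
    exact ⟨_, IsPairFamily.step_left hE hle hS hT⟩

/-- `S` is the family of vertex sets of monotone lattice paths from `(i, j)` to `(m, n)`. -/
structure IsPathFamily (m n i j : ℕ) (S : Finset (Finset (ℕ × ℕ))) : Prop where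
  chain : ∀ X ∈ S, IsNWChain X
  box : ∀ X ∈ S, ∀ s t, (s, t) ∈ X → i ≤ s ∧ s ≤ m ∧ j ≤ t ∧ t ≤ n
  mem_start : ∀ X ∈ S, (i, j) ∈ X
  card_mem : ∀ X ∈ S, X.card + i + j = m + n + 1
  complete : i ≤ m → j ≤ n → ∀ X, IsNWChain X →
    (∀ s t, (s, t) ∈ X → i ≤ s ∧ s ≤ m ∧ j ≤ t ∧ t ≤ n) → ∃ Z ∈ S, X ⊆ Z
  card_eq : (S.card : ℤ) = pathCount (m + 1 - i) (n + 1 - j)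

lemma isPathFamily_empty {m n i j : ℕ} (h : m < i ∨ n < j) : IsPathFamily m n i j ∅ := by
  refine ⟨by simp, by simp, by simp, by simp, fun _ _ => by omega, ?_⟩
  rw [pathCount, if_pos (by omega)]
  rfl

lemma isPathFamily_base (m n : ℕ) : IsPathFamily m n m n {{(m, n)}} := by
  refine ⟨?_, ?_, ?_, ?_, ?_, ?_⟩
  · intro X hX
    obtain rfl := Finset.mem_singleton.1 hX
    intro s t s' t' h h'
    simp only [Finset.mem_singleton, Prod.mk.injEq] at h h'
    omega
  · intro X hX s t h
    obtain rfl := Finset.mem_singleton.1 hX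
    simp only [Finset.mem_singleton, Prod.mk.injEq] at h
    omega
  · intro X hX
    obtain rfl := Finset.mem_singleton.1 hX
    simp
  · intro X hX
    obtain rfl := Finset.mem_singleton.1 hX
    simp
    omega
  · intro _ _ X _ hX
    refine ⟨_, Finset.mem_singleton_self _, ?_⟩
    rintro ⟨s, t⟩ hs
    have := hX s t hs
    simp only [Finset.mem_singleton, Prod.mk.injEq]
    omega
  · simp [pathCount]

lemma IsPathFamily.step {m n i j : ℕ} (hi : i ≤ m) (hj : j ≤ n) (hne : i + j < m + n)
    {S T : Finset (Finset (ℕ × ℕ))} (hS : IsPathFamily m n (i + 1) j S)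
    (hT : IsPathFamily m n i (j + 1) T) :
    IsPathFamily m n i j ((S ∪ T).image (insert (i, j))) := by
  have hS0 : ∀ Y ∈ S, (i, j) ∉ Y := by
    intro Y hY hm
    have := hS.box Y hY _ _ hm
    omega
  have hT0 : ∀ Y ∈ T, (i, j) ∉ Y := by
    intro Y hY hm
    have := hT.box Y hY _ _ hm
    omega
  have hST : Disjoint S T := by
    rw [Finset.disjoint_left]
    intro Y hY hY'
    have := hS.box Y hY _ _ (hT.mem_start Y hY')
    omega
  refine ⟨?_, ?_, ?_, ?_, ?_, ?_⟩
  · intro Y hY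
    simp only [Finset.mem_image, Finset.mem_union] at hY
    obtain ⟨Z, hZ | hZ, rfl⟩ := hY
    · have h1 := hS.chain Z hZ
      have h2 := hS.box Z hZ
      unfold IsNWChain at *
      simp only [Finset.mem_insert, Prod.mk.injEq]
      grind
    · have h1 := hT.chain Z hZ
      have h2 := hT.box Z hZ
      unfold IsNWChain at *
      simp only [Finset.mem_insert, Prod.mk.injEq]
      grind
  · intro Y hY s t hs
    simp only [Finset.mem_image, Finset.mem_union] at hY
    obtain ⟨Z, hZ | hZ, rfl⟩ := hY
    · have := hS.box Z hZ s t
      grind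
    · have := hT.box Z hZ s t
      grind
  · intro Y hY
    simp only [Finset.mem_image, Finset.mem_union] at hY
    obtain ⟨Z, -, rfl⟩ := hY
    exact Finset.mem_insert_self _ _
  · intro Y hY
    simp only [Finset.mem_image, Finset.mem_union] at hY
    obtain ⟨Z, hZ | hZ, rfl⟩ := hY
    · rw [Finset.card_insert_of_notMem (hS0 Z hZ)]
      have := hS.card_mem Z hZ
      omega
    · rw [Finset.card_insert_of_notMem (hT0 Z hZ)]
      have := hT.card_mem Z hZ
      omega
  · intro _ _ X hX hbox
    have hX' : IsNWChain (X.erase (i, j)) := fun s t s' t' h h' =>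
      hX s t s' t' (Finset.mem_of_mem_erase h) (Finset.mem_of_mem_erase h')
    by_cases h : (∃ t, (i, t) ∈ X ∧ j < t) ∨ i = m
    · obtain ⟨Z, hZ, hsub⟩ := hT.complete hi (by
        rcases h with ⟨t, ht, hjt⟩ | h
        · have := hbox _ _ ht
          omega
        · omega) _ hX' (by
        intro s t hs
        simp only [Finset.mem_erase, ne_eq, Prod.mk.injEq] at hs
        have h1 := hbox s t hs.2
        rcases h with ⟨t', ht', hjt⟩ | h
        · have hn : ¬(i < s ∧ t < t') := fun h => hX _ _ _ _ ht' hs.2 h.1 h.2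
          omega
        · omega)
      exact ⟨insert (i, j) Z, Finset.mem_image_of_mem _ (Finset.mem_union_right _ hZ),
        Finset.subset_insert_iff.2 hsub⟩
    · push Not at h
      obtain ⟨Z, hZ, hsub⟩ := hS.complete (by omega) hj _ hX' (by
        intro s t hs
        simp only [Finset.mem_erase, ne_eq, Prod.mk.injEq] at hs
        have h1 := hbox s t hs.2
        have h2 := h.1 t
        grind)
      exact ⟨insert (i, j) Z, Finset.mem_image_of_mem _ (Finset.mem_union_left _ hZ),
        Finset.subset_insert_iff.2 hsub⟩
  · rw [card_union_image_insert hS0 hT0 hST]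
    push_cast
    rw [hS.card_eq, hT.card_eq, pathCount_rec (m + 1 - i) (n + 1 - j) (by omega) (by omega)
      (by omega)]
    congr 2

lemma exists_isPathFamily (m n : ℕ) : ∀ N i j : ℕ, m + n + 2 = N + i + j → i ≤ m + 1 → j ≤ n + 1 →
    ∃ S, IsPathFamily m n i j S := by
  intro N
  induction N with
  | zero =>
    intro i j hN hi hj
    exact ⟨∅, isPathFamily_empty (by omega)⟩
  | succ N ih =>
    intro i j hN hi hj
    by_cases h : m < i ∨ n < j
    · exact ⟨∅, isPathFamily_empty h⟩
    by_cases hb : i = m ∧ j = n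
    · obtain ⟨rfl, rfl⟩ := hb
      exact ⟨_, isPathFamily_base i j⟩
    · obtain ⟨S, hS⟩ := ih (i + 1) j (by omega) (by omega) (by omega)
      obtain ⟨T, hT⟩ := ih i (j + 1) (by omega) (by omega) (by omega)
      exact ⟨_, hS.step (by omega) (by omega) (by omega) hT⟩

/-- The vertex set whose `x`-part is `X` and whose `y`-part is `Y`. -/
def joinParts (X Y : Finset (ℕ × ℕ)) : Finset V := ({true} ×ˢ X) ∪ ({false} ×ˢ Y)

/-- The `x`-part (for `true`) or `y`-part (for `false`) of a vertex set. -/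
def part (b : Bool) (F : Finset V) : Finset (ℕ × ℕ) := (F.filter fun v => v.1 = b).image Prod.snd

lemma mem_joinParts_true {X Y : Finset (ℕ × ℕ)} {s t : ℕ} :
    (true, s, t) ∈ joinParts X Y ↔ (s, t) ∈ X := by
  simp [joinParts]

lemma mem_joinParts_false {X Y : Finset (ℕ × ℕ)} {s t : ℕ} :
    (false, s, t) ∈ joinParts X Y ↔ (s, t) ∈ Y := by
  simp [joinParts]

lemma mem_part {b : Bool} {F : Finset V} {s t : ℕ} : (s, t) ∈ part b F ↔ (b, s, t) ∈ F := by
  simp [part]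

lemma card_joinParts (X Y : Finset (ℕ × ℕ)) : (joinParts X Y).card = X.card + Y.card := by
  rw [joinParts, Finset.card_union_of_disjoint, Finset.card_product, Finset.card_product]
  · simp
  · rw [Finset.disjoint_left]
    rintro ⟨b, s, t⟩ h1 h2
    simp only [Finset.mem_product, Finset.mem_singleton] at h1 h2
    simp [h1.1] at h2

lemma joinParts_injective {X Y X' Y' : Finset (ℕ × ℕ)} (h : joinParts X Y = joinParts X' Y') :
    X = X' ∧ Y = Y' := by
  constructor <;> ext ⟨s, t⟩
  · rw [← mem_joinParts_true (Y := Y), h, mem_joinParts_true]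
  · rw [← mem_joinParts_false (X := X), h, mem_joinParts_false]

lemma isFace_joinParts {m n i j : ℕ} {X Y : Finset (ℕ × ℕ)} (hi : 1 ≤ i) (him : i ≤ m)
    (hj : 1 ≤ j) (hjn : j ≤ n) (hX : IsNWChain X)
    (hbox : ∀ s t, (s, t) ∈ X → i ≤ s ∧ s ≤ m ∧ j ≤ t ∧ t ≤ n) (hY : IsTwoChain i n m j Y) :
    IsFace m n (joinParts X Y) := by
  simp only [IsFace, mem_joinParts_true, mem_joinParts_false]
  refine ⟨?_, ?_, ?_, ?_, ?_, ?_⟩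
  · rintro ⟨_ | _, s, t⟩ hs <;> simp only [mem_joinParts_true, mem_joinParts_false] at hs <;>
      simp only [InGrid]
    · have := hY.pos s t hs
      have := hY.cover s t hs
      omega
    · have := hbox s t hs
      omega
  · rintro s s' t t' h1 h2 ⟨h3, h4⟩
    exact hX _ _ _ _ h3 h4 h1 h2
  · rintro s s' t t' h1 h2 ⟨h3, h4⟩
    have := hbox _ _ h3
    have := hY.cover _ _ h4
    omega
  · rintro s s' s'' t t' t'' h1 h2 h3 h4 ⟨h5, h6, h7⟩
    have := hbox _ _ h5
    have := hY.right _ _ _ _ h7 h6 h1 h4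
    omega
  · rintro s s' s'' t t' t'' h1 h2 h3 h4 ⟨h5, h6, h7⟩
    have := hbox _ _ h5
    have := hY.left _ _ _ _ h6 h7 h2 h3
    omega
  · rintro s s' s'' t t' t'' h1 h2 h3 h4 ⟨h5, h6, h7⟩
    exact hY.noTriple _ _ _ _ _ _ h5 h6 h7 h1 h4 h2 h3

lemma IsFace.exists_corner {m n : ℕ} (hm : 2 ≤ m) (hn : 1 ≤ n) {F : Finset V}
    (hF : IsFace m n F) :
    IsNWChain (part true F) ∧ ∃ i j, 1 ≤ i ∧ i ≤ m ∧ 1 ≤ j ∧ j ≤ n ∧ ¬(i = m ∧ j = n) ∧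
      (∀ s t, (s, t) ∈ part true F → i ≤ s ∧ s ≤ m ∧ j ≤ t ∧ t ≤ n) ∧
      IsTwoChain i n m j (part false F) := by
  obtain ⟨hG, hA, hB, hC, hD, hE⟩ := hF
  have hgrid : ∀ b s t, (s, t) ∈ part b F → 1 ≤ s ∧ s ≤ m ∧ 1 ≤ t ∧ t ≤ n :=
    fun b s t h => hG _ (mem_part.1 h)
  have hchain : IsNWChain (part true F) := fun s t s' t' h h' h1 h2 =>
    hA _ _ _ _ h1 h2 ⟨mem_part.1 h, mem_part.1 h'⟩
  have htriple : ∀ s t s' t' s'' t'', (s, t) ∈ part false F → (s', t') ∈ part false F →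
      (s'', t'') ∈ part false F → s < s' → t' < t → s' < s'' → t'' < t' → False :=
    fun s t s' t' s'' t'' h h' h'' h1 h2 h3 h4 =>
      hE _ _ _ _ _ _ h1 h3 h4 h2 ⟨mem_part.1 h, mem_part.1 h', mem_part.1 h''⟩
  refine ⟨hchain, ?_⟩
  by_cases hX : ∃ s t, (s, t) ∈ part true F ∧ ¬(s = m ∧ t = n)
  · obtain ⟨s₀, t₀, h₀, hne⟩ := hX
    obtain ⟨⟨i, j⟩, hij, hmin⟩ := Finset.exists_min_image (part true F) (fun v => v.1 + v.2)
      ⟨_, h₀⟩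
    have hg := hgrid _ _ _ hij
    have hB' : ∀ s t, (s, t) ∈ part false F → ¬(i < s ∧ j < t) := fun s t h h' =>
      hB _ _ _ _ h'.1 h'.2 ⟨mem_part.1 hij, mem_part.1 h⟩
    refine ⟨i, j, hg.1, hg.2.1, hg.2.2.1, hg.2.2.2, ?_, ?_, ?_⟩
    · have := hmin _ h₀
      have := hgrid _ _ _ h₀
      simp only at *
      omega
    · intro s t hs
      have h1 := hmin _ hs
      have h2 := hgrid _ _ _ hs
      have h3 : ¬(i < s ∧ t < j) := fun h => hchain _ _ _ _ hij hs h.1 h.2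
      have h4 : ¬(s < i ∧ j < t) := fun h => hchain _ _ _ _ hs hij h.1 h.2
      simp only at h1
      omega
    · refine ⟨fun s t hs => ?_, fun s t hs => ?_, ?_, ?_, htriple⟩
      · have := hgrid _ _ _ hs
        omega
      · have := hgrid _ _ _ hs
        have := hB' _ _ hs
        omega
      · intro s t s' t' hs hs' h1 h2
        have h3 := hgrid _ _ _ hs
        have h4 := hgrid _ _ _ hs'
        have h5 := hB' _ _ hs
        by_contra hcon
        exact hD i s s' t' t j (by omega) h1 h2 (by omega)
          ⟨mem_part.1 hij, mem_part.1 hs, mem_part.1 hs'⟩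
      · intro s t s' t' hs hs' h1 h2
        have h3 := hgrid _ _ _ hs
        have h4 := hgrid _ _ _ hs'
        have h5 := hB' _ _ hs'
        by_contra hcon
        exact hC s s' i j t' t h1 (by omega) (by omega) h2
          ⟨mem_part.1 hij, mem_part.1 hs', mem_part.1 hs⟩
  · push Not at hX
    refine ⟨m - 1, n, by omega, by omega, hn, le_rfl, by omega, ?_, ?_⟩
    · intro s t hs
      have := hX _ _ hs
      omega
    · refine ⟨fun s t hs => ?_, fun s t hs => ?_, ?_, ?_, htriple⟩
      · have := hgrid _ _ _ hs
        omega
      · have := hgrid _ _ _ hs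
        omega
      · intro s t s' t' hs hs' h1 h2
        have h3 := hgrid _ _ _ hs
        have h4 := hgrid _ _ _ hs'
        omega
      · intro s t s' t' hs hs' h1 h2
        have h3 := hgrid _ _ _ hs
        have h4 := hgrid _ _ _ hs'
        omega

lemma ncard_isFacet (m n : ℕ) (hm : 2 ≤ m) (hn : 2 ≤ n) :
    ({F : Finset V | IsFacet m n F}.ncard : ℤ) =
      ∑ p ∈ ((Finset.Icc 1 m) ×ˢ (Finset.Icc 1 n)).erase (m, n),
        pathCount (m + 1 - p.1) (n + 1 - p.2) * pairCount p.1 n m p.2 := by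
  set I := ((Finset.Icc 1 m) ×ˢ (Finset.Icc 1 n)).erase (m, n) with hI
  have memI : ∀ p : ℕ × ℕ, p ∈ I ↔
      1 ≤ p.1 ∧ p.1 ≤ m ∧ 1 ≤ p.2 ∧ p.2 ≤ n ∧ ¬(p.1 = m ∧ p.2 = n) := by
    rintro ⟨i, j⟩
    simp only [hI, Finset.mem_erase, Finset.mem_product, Finset.mem_Icc, ne_eq, Prod.mk.injEq]
    tauto
  have hEnd : ∀ p ∈ I, EndPair p.1 n m p.2 := by
    intro p hp
    have := (memI p).1 hp
    unfold EndPair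
    omega
  have hS : ∀ p : ℕ × ℕ, ∃ S, p ∈ I → IsPathFamily m n p.1 p.2 S := by
    intro p
    by_cases hp : p ∈ I
    · have := (memI p).1 hp
      obtain ⟨S, hS⟩ := exists_isPathFamily m n (m + n + 2 - p.1 - p.2) p.1 p.2 (by omega)
        (by omega) (by omega)
      exact ⟨S, fun _ => hS⟩
    · exact ⟨∅, fun h => absurd h hp⟩
  have hT : ∀ p : ℕ × ℕ, ∃ T, p ∈ I → IsPairFamily p.1 n m p.2 T := by
    intro p
    by_cases hp : p ∈ I
    · obtain ⟨T, hT⟩ := exists_isPairFamily _ p.1 n m p.2 rfl (hEnd p hp)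
      exact ⟨T, fun _ => hT⟩
    · exact ⟨∅, fun h => absurd h hp⟩
  choose S hS using hS
  choose T hT using hT
  let 𝓕 : ℕ × ℕ → Finset (Finset V) := fun p =>
    (S p ×ˢ T p).image fun q => joinParts q.1 q.2
  have mem𝓕 : ∀ p F, F ∈ 𝓕 p ↔ ∃ X ∈ S p, ∃ Y ∈ T p, joinParts X Y = F := by
    intro p F
    simp only [𝓕, Finset.mem_image, Finset.mem_product, Prod.exists]
    constructor
    · rintro ⟨X, Y, ⟨hX, hY⟩, h⟩
      exact ⟨X, hX, Y, hY, h⟩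
    · rintro ⟨X, hX, Y, hY, h⟩
      exact ⟨X, Y, ⟨hX, hY⟩, h⟩
  have hface : ∀ p ∈ I, ∀ F ∈ 𝓕 p, IsFace m n F ∧ F.card + 2 = 2 * m + 2 * n := by
    intro p hp F hF
    obtain ⟨X, hX, Y, hY, rfl⟩ := (mem𝓕 p F).1 hF
    have hp' := (memI p).1 hp
    refine ⟨isFace_joinParts hp'.1 hp'.2.1 hp'.2.2.1 hp'.2.2.2.1 ((hS p hp).chain X hX)
      ((hS p hp).box X hX) ((hT p hp).twoChain Y hY), ?_⟩
    have h1 := (hS p hp).card_mem X hX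
    have h2 := (hT p hp).card_mem Y hY
    rw [card_joinParts]
    omega
  have hcover : ∀ F, IsFace m n F → ∃ p ∈ I, ∃ G ∈ 𝓕 p, F ⊆ G := by
    intro F hF
    obtain ⟨hX, i, j, h1, h2, h3, h4, h5, hbox, hY⟩ := hF.exists_corner hm (by omega)
    have hp : (i, j) ∈ I := (memI _).2 ⟨h1, h2, h3, h4, h5⟩
    obtain ⟨X, hXS, hXF⟩ := (hS _ hp).complete h2 h4 _ hX hbox
    obtain ⟨Y, hYT, hYF⟩ := (hT _ hp).complete (hEnd _ hp) _ hY
    refine ⟨_, hp, _, (mem𝓕 _ _).2 ⟨X, hXS, Y, hYT, rfl⟩, ?_⟩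
    rintro ⟨_ | _, s, t⟩ hs
    · exact mem_joinParts_false.2 (hYF (mem_part.2 hs))
    · exact mem_joinParts_true.2 (hXF (mem_part.2 hs))
  have hset : {F : Finset V | IsFacet m n F} = ↑(I.biUnion 𝓕) := by
    ext F
    simp only [Set.mem_ofPred_eq, Finset.coe_biUnion, Set.mem_iUnion, Finset.mem_coe, exists_prop]
    constructor
    · rintro ⟨hF, hmax⟩
      obtain ⟨p, hp, G, hG, hFG⟩ := hcover F hF
      exact ⟨p, hp, hmax G (hface p hp G hG).1 hFG ▸ hG⟩
    · rintro ⟨p, hp, hF⟩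
      refine ⟨(hface p hp F hF).1, fun G hG hFG => ?_⟩
      obtain ⟨p', hp', H, hH, hGH⟩ := hcover G hG
      have h1 := (hface p hp F hF).2
      have h2 := (hface p' hp' H hH).2
      have h3 := Finset.card_le_card hGH
      exact Finset.eq_of_subset_of_card_le hFG (by omega)
  rw [hset, Set.ncard_coe_finset, Finset.card_biUnion]
  · push_cast
    refine Finset.sum_congr rfl fun p hp => ?_
    rw [← (hS p hp).card_eq, ← (hT p hp).card_eq, Finset.card_image_of_injOn,
      Finset.card_product]
    · push_cast
      rfl
    · rintro ⟨X, Y⟩ - ⟨X', Y'⟩ - h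
      obtain ⟨rfl, rfl⟩ := joinParts_injective h
      rfl
  · intro p hp p' hp' hne
    change Disjoint (𝓕 p) (𝓕 p')
    rw [Finset.disjoint_left]
    intro F hF hF'
    obtain ⟨X, hX, Y, hY, rfl⟩ := (mem𝓕 p F).1 hF
    obtain ⟨X', hX', Y', hY', h⟩ := (mem𝓕 p' _).1 hF'
    obtain ⟨rfl, rfl⟩ := joinParts_injective h
    have h1 := (hS p hp).box _ hX _ _ ((hS p' hp').mem_start _ hX')
    have h2 := (hS p' hp').box _ hX' _ _ ((hS p hp).mem_start _ hX)
    exact hne (Prod.ext (by omega) (by omega))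

lemma sum_Icc_mul_pred (u v : ℕ → ℤ) (N : ℕ) (hv : v 0 = 0) (hu : u (N + 1) = 0) :
    ∑ k ∈ Finset.Icc 1 N, u k * v (k - 1) = ∑ k ∈ Finset.Icc 1 N, u (k + 1) * v k := by
  have key : ∀ M, ∑ k ∈ Finset.Icc 1 M, u k * v (k - 1) + u (M + 1) * v M =
      ∑ k ∈ Finset.Icc 1 M, u (k + 1) * v k := by
    intro M
    induction M with
    | zero => simp [hv]
    | succ M ih =>
      rw [Finset.sum_Icc_succ_top (by omega), Finset.sum_Icc_succ_top (by omega), ← ih]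
      simp
  rw [← key N, hu]
  ring

lemma pathCount_rec_rev {m n i j : ℕ} (hi : i ≤ m) (hj : j ≤ n) :
    pathCount (m + 1 - i) (n + 1 - j) - pathCount (m + 1 - i) (n + 1 - (j + 1)) -
      pathCount (m + 1 - (i + 1)) (n + 1 - j) = if i = m ∧ j = n then 1 else 0 := by
  split_ifs with h
  · obtain ⟨rfl, rfl⟩ := h
    simp [pathCount]
  · rw [pathCount_rec (m + 1 - i) (n + 1 - j) (by omega) (by omega) (by omega)]
    simp only [Nat.sub_sub]
    ring

lemma sum_pathCount_mul_pairCount (m n : ℕ) (hm : 2 ≤ m) (hn : 1 ≤ n) :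
    ∑ p ∈ ((Finset.Icc 1 m) ×ˢ (Finset.Icc 1 n)).erase (m, n),
      pathCount (m + 1 - p.1) (n + 1 - p.2) * pairCount p.1 n m p.2 = pathCount m n ^ 2 := by
  rw [Finset.sum_erase _ (by simp [pairCount]), Finset.sum_product]
  set w : ℕ → ℕ → ℤ := fun i j => pathCount (m + 1 - i) (n + 1 - j) with hw
  set f : ℕ → ℤ := fun i => pathCount i n with hf
  set g : ℕ → ℤ := fun j => pathCount m j with hg
  have hf0 : f 0 = 0 := pathCount_zero_left _
  have hg0 : g 0 = 0 := pathCount_zero_right _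
  have hsplit : ∀ i ∈ Finset.Icc 1 m, ∀ j ∈ Finset.Icc 1 n,
      pathCount (m + 1 - i) (n + 1 - j) * pairCount i n m j =
        w i j * (f i * g j) - f i * (w i j * g (j - 1)) - g j * (w i j * f (i - 1)) := by
    intro i hi j hj
    rw [Finset.mem_Icc] at hi hj
    simp only [hw, hf, hg, pairCount]
    rw [pathCount_rec m j (by omega) (by omega) (by omega)]
    ring
  have hrow : ∀ i, ∑ j ∈ Finset.Icc 1 n, w i j * g (j - 1) =
      ∑ j ∈ Finset.Icc 1 n, w i (j + 1) * g j := fun i =>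
    sum_Icc_mul_pred (w i) g n hg0 (by simp [hw, pathCount_zero_right])
  have hcol : ∀ j, ∑ i ∈ Finset.Icc 1 m, w i j * f (i - 1) =
      ∑ i ∈ Finset.Icc 1 m, w (i + 1) j * f i := fun j =>
    sum_Icc_mul_pred (fun i => w i j) f m hf0 (by simp [hw, pathCount_zero_left])
  calc ∑ i ∈ Finset.Icc 1 m, ∑ j ∈ Finset.Icc 1 n,
        pathCount (m + 1 - i) (n + 1 - j) * pairCount i n m j
      = ∑ i ∈ Finset.Icc 1 m, ∑ j ∈ Finset.Icc 1 n, w i j * (f i * g j)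
        - ∑ i ∈ Finset.Icc 1 m, f i * ∑ j ∈ Finset.Icc 1 n, w i j * g (j - 1)
        - ∑ j ∈ Finset.Icc 1 n, g j * ∑ i ∈ Finset.Icc 1 m, w i j * f (i - 1) := by
        simp only [Finset.mul_sum]
        rw [Finset.sum_comm (s := Finset.Icc 1 n), ← Finset.sum_sub_distrib,
          ← Finset.sum_sub_distrib]
        refine Finset.sum_congr rfl fun i hi => ?_
        rw [← Finset.sum_sub_distrib, ← Finset.sum_sub_distrib]
        exact Finset.sum_congr rfl fun j hj => hsplit i hi j hj
    _ = ∑ i ∈ Finset.Icc 1 m, ∑ j ∈ Finset.Icc 1 n,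
          f i * g j * (w i j - w i (j + 1) - w (i + 1) j) := by
        simp only [hrow, hcol, Finset.mul_sum]
        rw [Finset.sum_comm (s := Finset.Icc 1 n), ← Finset.sum_sub_distrib,
          ← Finset.sum_sub_distrib]
        refine Finset.sum_congr rfl fun i _ => ?_
        rw [← Finset.sum_sub_distrib, ← Finset.sum_sub_distrib]
        exact Finset.sum_congr rfl fun j _ => by ring
    _ = ∑ i ∈ Finset.Icc 1 m, ∑ j ∈ Finset.Icc 1 n,
          if i = m ∧ j = n then f m * g n else 0 := by
        refine Finset.sum_congr rfl fun i hi => Finset.sum_congr rfl fun j hj => ?_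
        rw [Finset.mem_Icc] at hi hj
        simp only [hw]
        rw [pathCount_rec_rev hi.2 hj.2]
        split_ifs with h
        · rw [h.1, h.2, mul_one]
        · rw [mul_zero]
    _ = pathCount m n ^ 2 := by
        have h1 : 1 ≤ m := by omega
        simp only [ite_and, Finset.sum_ite_irrel, Finset.sum_const_zero, Finset.sum_ite_eq',
          Finset.mem_Icc, h1, hn, le_refl, and_self, if_true]
        ring

theorem facet_count (m n : ℕ) (hm : 2 ≤ m) (hmn : m ≤ n) :
    (({F : Finset V | IsFacet m n F}.ncard : ℤ) =
        ∑ p ∈ ((Finset.Icc 1 m) ×ˢ (Finset.Icc 1 n)).erase (m, n),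
          binom ((m : ℤ) + n - p.1 - p.2) ((m : ℤ) - p.1) *
            (Matrix.of ![![binom ((p.1 : ℤ) + n - 2) ((p.1 : ℤ) - 1),
                           binom ((m : ℤ) + p.2 - 2) ((m : ℤ) - 1)],
                         ![binom ((p.1 : ℤ) + n - 3) ((p.1 : ℤ) - 2),
                           binom ((m : ℤ) + p.2 - 3) ((m : ℤ) - 2)]]).det) ∧
      ({F : Finset V | IsFacet m n F}.ncard : ℤ) =
        (binom ((m : ℤ) + n - 2) ((m : ℤ) - 1)) ^ 2 := by
  have hcount := ncard_isFacet m n hm (hm.trans hmn)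
  refine ⟨?_, ?_⟩
  · rw [hcount]
    refine Finset.sum_congr rfl fun p hp => ?_
    simp only [Finset.mem_erase, Finset.mem_product, Finset.mem_Icc] at hp
    obtain ⟨-, ⟨h1, h2⟩, h3, h4⟩ := hp
    rw [Matrix.det_fin_two_of,
      binom_eq_pathCount (m + 1 - p.1) (n + 1 - p.2) _ _ (by omega) (by omega) (by omega),
      binom_eq_pathCount p.1 n _ _ rfl rfl (by omega),
      binom_eq_pathCount m p.2 _ _ rfl rfl h3,
      binom_eq_pathCount (m - 1) p.2 _ _ (by omega) (by omega) h3,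
      binom_eq_pathCount (p.1 - 1) n _ _ (by omega) (by omega) (by omega), pairCount]
  · rw [hcount, sum_pathCount_mul_pairCount m n hm (by omega),
      binom_eq_pathCount m n _ _ rfl rfl (by omega)]
end

section
/- The simplicial complex Δ_{LT(J)} is shellable: there exists a total order F₁, F₂, …, F_e of its facets such that for all 1 ≤ j < i ≤ e there exist v ∈ F_i \ F_j and an index k with 1 ≤ k < i and F_i \ F_k = {v}. -/
/-- A function that increases by `0` or `1` at each step. It encodes the lattice path which meets
the antidiagonal `i + j = s` in row `ρ s`. -/
def IsStep (ρ : ℕ → ℕ) : Prop :=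
  ∀ s, ρ s ≤ ρ (s + 1) ∧ ρ (s + 1) ≤ ρ s + 1

theorem IsStep.le_and_le {ρ : ℕ → ℕ} (h : IsStep ρ) {s t : ℕ} (hst : s ≤ t) :
    ρ s ≤ ρ t ∧ ρ t + s ≤ ρ s + t := by
  induction t, hst using Nat.le_induction with
  | base => simp
  | succ t _ ih =>
    have := h t
    omega

/-- Flipping a corner of a lattice path gives a lattice path. -/
theorem IsStep.update {ρ : ℕ → ℕ} (h : IsStep ρ) {s : ℕ} (h₁ : ρ (s + 1) = ρ s)
    (h₂ : ρ (s + 2) = ρ s + 1) : IsStep (Function.update ρ (s + 1) (ρ (s + 1) + 1)) := by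
  intro t
  have := h t
  have : ρ (s + 1 + 1) = ρ s + 1 := h₂
  simp only [Function.update_apply]
  split_ifs with h₃ h₄ h₄
  · omega
  · subst h₃
    omega
  · obtain rfl : t = s := by omega
    omega
  · omega

/-- If `γ` and `ρ` agree at both ends and `γ` exceeds `ρ` somewhere, then it exceeds `ρ` at a
corner of `ρ`. -/
theorem IsStep.exists_corner {ρ γ : ℕ → ℕ} (hρ : IsStep ρ) (hγ : IsStep γ) {s t u : ℕ}
    (hs : γ s = ρ s) (ht : γ t = ρ t) (hsu : s ≤ u) (hut : u ≤ t) (hu : ρ u < γ u) :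
    ∃ w, s ≤ w ∧ w + 2 ≤ t ∧ ρ (w + 1) = ρ w ∧ ρ (w + 2) = ρ w + 1 ∧ ρ (w + 1) < γ (w + 1) := by
  obtain ⟨w, hsw, hwt, hw, hlt⟩ :
      ∃ w, s ≤ w ∧ w + 1 ≤ t ∧ ρ (w + 1) = ρ w ∧ ρ (w + 1) < γ (w + 1) := by
    induction u, hsu using Nat.le_induction with
    | base => omega
    | succ u hsu ih =>
      by_cases hflat : ρ (u + 1) = ρ u
      · exact ⟨u, hsu, hut, hflat, hu⟩
      · have := hρ u
        have := hγ u
        exact ih (by omega) (by omega)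
  obtain ⟨d, rfl⟩ := Nat.exists_eq_add_of_le hwt
  clear hu hut hsu
  induction d generalizing w with
  | zero => simp only [Nat.add_zero] at ht; omega
  | succ d ih =>
    have h₁ := hρ (w + 1)
    have h₂ := hγ (w + 1)
    by_cases hflat : ρ (w + 2) = ρ w + 1
    · exact ⟨w, hsw, by omega, hw, hflat, hlt⟩
    · have e : w + 1 + 1 = w + 2 := rfl
      rw [e] at h₁ h₂
      have := ih (w + 1) (by omega) (by rw [e]; omega) (by rw [e]; omega)
        (by rwa [show w + 1 + 1 + d = w + 1 + (d + 1) by omega]) (by omega)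
      obtain ⟨z, h⟩ := this
      exact ⟨z, h.1, by omega, h.2.2⟩

/-- The north-east-most lattice path through a chain. -/
theorem exists_isStep_min {S : Finset (ℕ × ℕ)} (hS : S.Nonempty)
    (hchain : ∀ p ∈ S, ∀ q ∈ S, p.1 < q.1 → p.2 ≤ q.2) :
    ∃ ρ : ℕ → ℕ, IsStep ρ ∧ (∀ p ∈ S, ρ (p.1 + p.2) = p.1) ∧
      ∀ s, ∃ p ∈ S, ρ s = min p.1 (s - p.2) := by
  refine ⟨fun s => S.sup' hS fun p => min p.1 (s - p.2), fun s => ⟨?_, ?_⟩, fun p hp => ?_,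
    fun s => Finset.exists_mem_eq_sup' hS _⟩
  · refine Finset.sup'_le _ _ fun p hp => ?_
    exact le_trans (by omega) (Finset.le_sup' (fun p : ℕ × ℕ => min p.1 (s + 1 - p.2)) hp)
  · refine Finset.sup'_le _ _ fun p hp => ?_
    have := Finset.le_sup' (fun p : ℕ × ℕ => min p.1 (s - p.2)) hp
    beta_reduce at this ⊢
    omega
  · refine le_antisymm (Finset.sup'_le _ _ fun q hq => ?_) ?_
    · have := hchain p hp q hq
      omega
    · exact le_trans (by omega)
        (Finset.le_sup' (fun q : ℕ × ℕ => min q.1 (p.1 + p.2 - q.2)) hp)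

/-- The south-west-most lattice path through a chain. -/
theorem exists_isStep_max {S : Finset (ℕ × ℕ)} (hS : S.Nonempty)
    (hchain : ∀ p ∈ S, ∀ q ∈ S, p.1 < q.1 → p.2 ≤ q.2) :
    ∃ ρ : ℕ → ℕ, IsStep ρ ∧ (∀ p ∈ S, ρ (p.1 + p.2) = p.1) ∧
      ∀ s, ∃ p ∈ S, ρ s = max p.1 (s - p.2) := by
  refine ⟨fun s => S.inf' hS fun p => max p.1 (s - p.2), fun s => ⟨?_, ?_⟩, fun p hp => ?_,
    fun s => Finset.exists_mem_eq_inf' hS _⟩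
  · refine Finset.le_inf' _ _ fun p hp => ?_
    exact le_trans (Finset.inf'_le (fun p : ℕ × ℕ => max p.1 (s - p.2)) hp) (by omega)
  · obtain ⟨p, hp, h⟩ := Finset.exists_mem_eq_inf' hS fun p : ℕ × ℕ => max p.1 (s - p.2)
    have := Finset.inf'_le (fun p : ℕ × ℕ => max p.1 (s + 1 - p.2)) hp
    beta_reduce at this h ⊢
    omega
  · refine le_antisymm ?_ (Finset.le_inf' _ _ fun q hq => ?_)
    · exact le_trans (Finset.inf'_le (fun q : ℕ × ℕ => max q.1 (p.1 + p.2 - q.2)) hp) (by omega)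
    · have := hchain q hq p hp
      omega

/-- The vertices of the lattice path `ρ` on the antidiagonals `s, …, t`, in the matrix `c`. -/
def pathSet (c : Bool) (ρ : ℕ → ℕ) (s t : ℕ) : Finset V :=
  (Finset.Icc s t).image fun u => (c, ρ u, u - ρ u)

theorem mem_pathSet {c d : Bool} {ρ : ℕ → ℕ} {s t i j : ℕ} (hρ : IsStep ρ) (hs : ρ s ≤ s) :
    (d, i, j) ∈ pathSet c ρ s t ↔ d = c ∧ s ≤ i + j ∧ i + j ≤ t ∧ ρ (i + j) = i := by
  simp only [pathSet, Finset.mem_image, Finset.mem_Icc, Prod.mk.injEq]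
  constructor
  · rintro ⟨u, ⟨h₁, h₂⟩, rfl, rfl, rfl⟩
    have := hρ.le_and_le h₁
    have e : ρ u + (u - ρ u) = u := by omega
    rw [e]
    simp [h₁, h₂]
  · rintro ⟨rfl, h₁, h₂, h₃⟩
    exact ⟨i + j, ⟨h₁, h₂⟩, rfl, h₃, by omega⟩

theorem sum_pathSet {c : Bool} {ρ : ℕ → ℕ} {s t : ℕ} (hρ : IsStep ρ) (hs : ρ s ≤ s) (g : V → ℕ) :
    ∑ v ∈ pathSet c ρ s t, g v = ∑ u ∈ Finset.Icc s t, g (c, ρ u, u - ρ u) := by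
  refine Finset.sum_image fun u hu w hw h => ?_
  simp only [Finset.coe_Icc, Set.mem_Icc, Prod.mk.injEq, true_and] at hu hw h
  have := hρ.le_and_le hu.1
  have := hρ.le_and_le hw.1
  omega

/-- The data of a facet of `Δ_{LT(J)}`: disjoint lattice paths `p` from `(1,1)` to `(a,n)` and `q`
from `(2,1)` to `(m,b)` in `Y`, and a lattice path `r` from `(a,b)` to `(m,n)` in `X`. -/
structure IsPathTriple (m n a b : ℕ) (p q r : ℕ → ℕ) : Prop where
  one_le_a : 1 ≤ a
  a_le : a ≤ m
  one_le_b : 1 ≤ b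
  b_le : b ≤ n
  lt_or_lt : a < m ∨ b < n
  p_step : IsStep p
  q_step : IsStep q
  r_step : IsStep r
  p_start : p 2 = 1
  p_end : p (a + n) = a
  q_start : q 3 = 2
  q_end : q (m + b) = m
  r_start : r (a + b) = a
  r_end : r (m + n) = m
  p_lt_q : ∀ s, 3 ≤ s → s ≤ a + n → s ≤ m + b → p s < q s

def tripleSet (m n a b : ℕ) (p q r : ℕ → ℕ) : Finset V :=
  pathSet true r (a + b) (m + n) ∪ (pathSet false p 2 (a + n) ∪ pathSet false q 3 (m + b))

namespace IsPathTriple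

variable {m n a b : ℕ} {p q r : ℕ → ℕ}

theorem mem_true (h : IsPathTriple m n a b p q r) {i j : ℕ} :
    (true, i, j) ∈ tripleSet m n a b p q r ↔ a + b ≤ i + j ∧ i + j ≤ m + n ∧ r (i + j) = i := by
  have := h.r_start
  have := h.p_start
  have := h.q_start
  simp only [tripleSet, Finset.mem_union]
  rw [mem_pathSet h.r_step (by omega), mem_pathSet h.p_step (by omega),
    mem_pathSet h.q_step (by omega)]
  simp

theorem mem_false (h : IsPathTriple m n a b p q r) {i j : ℕ} :
    (false, i, j) ∈ tripleSet m n a b p q r ↔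
      (2 ≤ i + j ∧ i + j ≤ a + n ∧ p (i + j) = i) ∨
        (3 ≤ i + j ∧ i + j ≤ m + b ∧ q (i + j) = i) := by
  have := h.r_start
  have := h.p_start
  have := h.q_start
  simp only [tripleSet, Finset.mem_union]
  rw [mem_pathSet h.r_step (by omega), mem_pathSet h.p_step (by omega),
    mem_pathSet h.q_step (by omega)]
  simp

theorem sum_eq (h : IsPathTriple m n a b p q r) (g : V → ℕ) :
    ∑ v ∈ tripleSet m n a b p q r, g v =
      ∑ s ∈ Finset.Icc (a + b) (m + n), g (true, r s, s - r s) +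
        (∑ s ∈ Finset.Icc 2 (a + n), g (false, p s, s - p s) +
          ∑ s ∈ Finset.Icc 3 (m + b), g (false, q s, s - q s)) := by
  have := h.r_start
  have := h.p_start
  have := h.q_start
  rw [tripleSet, Finset.sum_union, Finset.sum_union, sum_pathSet h.r_step (by omega),
    sum_pathSet h.p_step (by omega), sum_pathSet h.q_step (by omega)]
  · rw [Finset.disjoint_left]
    rintro ⟨c, i, j⟩ h₁ h₂
    rw [mem_pathSet h.p_step (by omega)] at h₁
    rw [mem_pathSet h.q_step (by omega)] at h₂
    have := h.p_lt_q (i + j)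
    omega
  · rw [Finset.disjoint_left]
    rintro ⟨c, i, j⟩ h₁ h₂
    rw [mem_pathSet h.r_step (by omega)] at h₁
    rw [Finset.mem_union, mem_pathSet h.p_step (by omega), mem_pathSet h.q_step (by omega)] at h₂
    simp_all

theorem card_eq (h : IsPathTriple m n a b p q r) (hm : 2 ≤ m) (hn : 2 ≤ n) :
    (tripleSet m n a b p q r).card = 2 * (m + n - 1) := by
  have := h.sum_eq fun _ => 1
  have := h.a_le
  have := h.b_le
  have := h.one_le_a
  have := h.one_le_b
  simp only [Finset.sum_const, Nat.card_Icc, smul_eq_mul, mul_one] at *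
  omega

theorem bounds_true (h : IsPathTriple m n a b p q r) {i j : ℕ}
    (hv : (true, i, j) ∈ tripleSet m n a b p q r) : a ≤ i ∧ i ≤ m ∧ b ≤ j ∧ j ≤ n := by
  obtain ⟨h₁, h₂, h₃⟩ := h.mem_true.1 hv
  have := h.r_step.le_and_le h₁
  have := h.r_step.le_and_le h₂
  have := h.r_start
  have := h.r_end
  omega

theorem bounds_p (h : IsPathTriple m n a b p q r) {s : ℕ} (h₁ : 2 ≤ s) (h₂ : s ≤ a + n) :
    1 ≤ p s ∧ p s ≤ a ∧ p s + 1 ≤ s ∧ s ≤ p s + n := by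
  have := h.p_step.le_and_le h₁
  have := h.p_step.le_and_le h₂
  have := h.p_start
  have := h.p_end
  omega

theorem bounds_q (h : IsPathTriple m n a b p q r) {s : ℕ} (h₁ : 3 ≤ s) (h₂ : s ≤ m + b) :
    2 ≤ q s ∧ q s ≤ m ∧ q s + 1 ≤ s ∧ s ≤ q s + b := by
  have := h.q_step.le_and_le h₁
  have := h.q_step.le_and_le h₂
  have := h.q_start
  have := h.q_end
  omega

theorem isFace (h : IsPathTriple m n a b p q r) : IsFace m n (tripleSet m n a b p q r) := by
  have ha := h.one_le_a
  have ha' := h.a_le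
  have hb := h.one_le_b
  have hb' := h.b_le
  have chain : ∀ {ρ : ℕ → ℕ}, IsStep ρ → ∀ {i j k l : ℕ}, ρ (i + l) = i → ρ (j + k) = j →
      i < j → l ≤ k := by
    intro ρ hρ i j k l h₁ h₂ h₃
    rcases le_total (i + l) (j + k) with h₅ | h₅
    · have := hρ.le_and_le h₅
      omega
    · have := hρ.le_and_le h₅
      omega
  have mem : ∀ {i j : ℕ}, (false, i, j) ∈ tripleSet m n a b p q r →
      (p (i + j) = i ∧ 1 ≤ i ∧ 1 ≤ j ∧ i ≤ a ∧ j ≤ n) ∨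
        (q (i + j) = i ∧ 1 ≤ i ∧ 1 ≤ j ∧ i ≤ m ∧ j ≤ b) := by
    intro i j hv
    rcases h.mem_false.1 hv with ⟨h₁, h₂, h₃⟩ | ⟨h₁, h₂, h₃⟩
    · have := h.bounds_p h₁ h₂
      omega
    · have := h.bounds_q h₁ h₂
      omega
  refine ⟨?_, ?_, ?_, ?_, ?_, ?_⟩
  · rintro ⟨c, i, j⟩ hv
    rw [InGrid]
    cases c
    · have := mem hv
      simp only
      omega
    · have := h.bounds_true hv
      simp only
      omega
  · rintro i j k l hij hkl ⟨h₁, h₂⟩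
    exact hkl.not_ge (chain h.r_step (h.mem_true.1 h₁).2.2 (h.mem_true.1 h₂).2.2 hij)
  · rintro i j k l hij hkl ⟨h₁, h₂⟩
    have := h.bounds_true h₁
    have := mem h₂
    omega
  · rintro i j k x y z hij hjk hxy hyz ⟨h₁, h₂, h₃⟩
    have := h.bounds_true h₁
    have h₂ := mem h₂
    have h₃ := mem h₃
    exact hyz.not_ge (chain h.p_step (by omega) (by omega) hij)
  · rintro i j k x y z hij hjk hxy hyz ⟨h₁, h₂, h₃⟩
    have := h.bounds_true h₁
    have h₂ := mem h₂
    have h₃ := mem h₃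
    exact hxy.not_ge (chain h.q_step (by omega) (by omega) hjk)
  · rintro i j k x y z hij hjk hxy hyz ⟨h₁, h₂, h₃⟩
    have hp₁ := chain h.p_step (i := i) (j := j) (k := y) (l := z)
    have hp₂ := chain h.p_step (i := j) (j := k) (k := x) (l := y)
    have hp₃ := chain h.p_step (i := i) (j := k) (k := x) (l := z)
    have hq₁ := chain h.q_step (i := i) (j := j) (k := y) (l := z)
    have hq₂ := chain h.q_step (i := j) (j := k) (k := x) (l := y)
    have hq₃ := chain h.q_step (i := i) (j := k) (k := x) (l := z)
    have h₁ := mem h₁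
    have h₂ := mem h₂
    have h₃ := mem h₃
    omega

end IsPathTriple

/-- A face whose `X`-part lies weakly south-east of `(a,b)`, and whose `Y`-part satisfies the
conditions imposed by the vertex `x_{a,b}`, lies in a path triple starting at `(a,b)`. -/
theorem IsFace.exists_triple {m n a b : ℕ} {F : Finset V} (hF : IsFace m n F)
    (hm : 2 ≤ m) (hn : 2 ≤ n) (ha : 1 ≤ a) (ham : a ≤ m) (hb : 1 ≤ b) (hbn : b ≤ n)
    (hab : a < m ∨ b < n) (hX : ∀ i j, (true, i, j) ∈ F → a ≤ i ∧ b ≤ j)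
    (hL : ∀ i j, (false, i, j) ∈ F → i ≤ a ∨ j ≤ b)
    (hC : ∀ i j k l, (false, i, l) ∈ F → (false, j, k) ∈ F → i < j → j ≤ a → b < k → l ≤ k)
    (hD : ∀ i j k l, (false, i, l) ∈ F → (false, j, k) ∈ F → i < j → a < i → l ≤ b → l ≤ k) :
    ∃ p q r, IsPathTriple m n a b p q r ∧ F ⊆ tripleSet m n a b p q r := by
  classical
  obtain ⟨hgrid, hA, -, -, -, hE⟩ := hF
  have grid : ∀ {c i j}, (c, i, j) ∈ F → 1 ≤ i ∧ i ≤ m ∧ 1 ≤ j ∧ j ≤ n := fun h => hgrid _ h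
  -- `P` selects the vertices of `Y` to be put on the lower path `q`.
  let P : ℕ × ℕ → Prop := fun x => x.2 ≤ b ∧ 2 ≤ x.1 ∧
    (a < x.1 ∨ x.1 = m ∨ x.2 = 1 ∨ ∃ k l, (false, k, l) ∈ F ∧ k < x.1 ∧ x.2 < l)
  let S₁ := insert (1, 1) (insert (a, n) ((F.image Prod.snd).filter
    fun x => (false, x) ∈ F ∧ ¬ P x))
  let S₂ := insert (2, 1) (insert (m, b) ((F.image Prod.snd).filter
    fun x => (false, x) ∈ F ∧ P x))
  let S₃ := insert (a, b) (insert (m, n) ((F.image Prod.snd).filter fun x => (true, x) ∈ F))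
  have mem₁ : ∀ x, x ∈ S₁ ↔ x = (1, 1) ∨ x = (a, n) ∨ ((false, x) ∈ F ∧ ¬ P x) := by
    intro x
    simp only [S₁, Finset.mem_insert, Finset.mem_filter, Finset.mem_image]
    exact or_congr_right (or_congr_right ⟨And.right, fun h => ⟨⟨_, h.1, rfl⟩, h⟩⟩)
  have mem₂ : ∀ x, x ∈ S₂ ↔ x = (2, 1) ∨ x = (m, b) ∨ ((false, x) ∈ F ∧ P x) := by
    intro x
    simp only [S₂, Finset.mem_insert, Finset.mem_filter, Finset.mem_image]
    exact or_congr_right (or_congr_right ⟨And.right, fun h => ⟨⟨_, h.1, rfl⟩, h⟩⟩)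
  have mem₃ : ∀ x, x ∈ S₃ ↔ x = (a, b) ∨ x = (m, n) ∨ (true, x) ∈ F := by
    intro x
    simp only [S₃, Finset.mem_insert, Finset.mem_filter, Finset.mem_image]
    exact or_congr_right (or_congr_right ⟨And.right, fun h => ⟨⟨_, h, rfl⟩, h⟩⟩)
  have row_le : ∀ {i j}, (false, i, j) ∈ F → ¬ P (i, j) → i ≤ a := by
    intro i j h hP
    by_contra hi
    have := hL i j h
    exact hP ⟨by simp only; omega, by simp only; omega, Or.inl (by simp only; omega)⟩
  obtain ⟨p, p_step, p_mem, hp⟩ := exists_isStep_min (S := S₁) ⟨(1, 1), by simp [mem₁]⟩ <| by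
    rintro ⟨i, l⟩ hx ⟨j, k⟩ hy hij
    rw [mem₁] at hx hy
    simp only [Prod.mk.injEq] at *
    rcases hy with hy | hy | ⟨hy, hPy⟩
    · rcases hx with hx | hx | ⟨hx, -⟩
      · omega
      · omega
      · have := grid hx
        omega
    · rcases hx with hx | hx | ⟨hx, -⟩
      · omega
      · omega
      · have := grid hx
        omega
    · rcases hx with hx | hx | ⟨hx, -⟩
      · have := grid hy
        omega
      · have := row_le hy hPy
        omega
      · by_contra hkl
        have := row_le hy hPy
        have := grid hx
        refine hPy ⟨?_, by simp only; omega, Or.inr (Or.inr (Or.inr ⟨i, l, hx, hij, by omega⟩))⟩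
        by_contra hb
        exact hkl (hC i j k l hx hy hij (row_le hy hPy) (by omega))
  obtain ⟨q, q_step, q_mem, hq⟩ := exists_isStep_max (S := S₂) ⟨(2, 1), by simp [mem₂]⟩ <| by
    rintro ⟨i, l⟩ hx ⟨j, k⟩ hy hij
    rw [mem₂] at hx hy
    simp only [Prod.mk.injEq] at *
    rcases hy with hy | hy | ⟨hy, hPy⟩
    · rcases hx with hx | hx | ⟨hx, hPx⟩
      · omega
      · omega
      · have := hPx.2.1
        simp only at this
        omega
    · rcases hx with hx | hx | ⟨hx, hPx⟩
      · omega
      · omega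
      · have := hPx.1
        simp only at this
        omega
    · rcases hx with hx | hx | ⟨hx, hPx⟩
      · have := grid hy
        omega
      · have := grid hy
        omega
      · have := grid hx
        have := grid hy
        by_contra hkl
        obtain ⟨h₁, h₂, h₃ | h₃ | h₃ | ⟨i', l', h₃, h₄, h₅⟩⟩ := hPx
        · exact hkl (hD i j k l hx hy hij h₃ h₁)
        · simp only at h₃
          omega
        · simp only at h₃
          omega
        · exact hE i' i j k l l' h₄ hij (by omega) h₅ ⟨h₃, hx, hy⟩
  obtain ⟨r, r_step, r_mem, -⟩ := exists_isStep_min (S := S₃) ⟨(a, b), by simp [mem₃]⟩ <| by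
    rintro ⟨i, l⟩ hx ⟨j, k⟩ hy hij
    rw [mem₃] at hx hy
    simp only [Prod.mk.injEq] at *
    rcases hx with hx | hx | hx
    · rcases hy with hy | hy | hy
      · omega
      · omega
      · have := hX _ _ hy
        omega
    · rcases hy with hy | hy | hy
      · omega
      · omega
      · have := grid hy
        omega
    · rcases hy with hy | hy | hy
      · have := hX _ _ hx
        omega
      · have := grid hx
        omega
      · by_contra hkl
        exact hA i j k l hij (by omega) ⟨hx, hy⟩
  have hsep : ∀ x ∈ S₁, ∀ y ∈ S₂, y.1 ≤ x.1 → y.2 < x.2 := by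
    rintro ⟨i, j⟩ hx ⟨k, l⟩ hy hik
    rw [mem₁] at hx
    rw [mem₂] at hy
    simp only [Prod.mk.injEq] at *
    by_contra hjl
    rcases hx with hx | hx | ⟨hx, hPx⟩
    · rcases hy with hy | hy | ⟨hy, hPy⟩
      · omega
      · omega
      · have := hPy.2.1
        simp only at this
        omega
    · rcases hy with hy | hy | ⟨hy, hPy⟩
      · omega
      · omega
      · obtain ⟨h₁, h₂, h₃ | h₃ | h₃ | ⟨i', l', h₃, h₄, h₅⟩⟩ := hPy
        · simp only at h₁ h₂ h₃
          omega
        · simp only at h₁ h₂ h₃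
          omega
        · simp only at h₁ h₂ h₃
          omega
        · have := grid h₃
          simp only at h₅
          omega
    · have := grid hx
      refine hPx ?_
      rcases hy with hy | hy | ⟨hy, hPy⟩
      · exact ⟨by simp only; omega, by simp only; omega,
          Or.inr (Or.inr (Or.inl (by simp only; omega)))⟩
      · exact ⟨by simp only; omega, by simp only; omega, Or.inr (Or.inl (by simp only; omega))⟩
      · have := grid hy
        obtain ⟨h₁, h₂, h₃⟩ := hPy
        simp only at h₁ h₂ h₃
        refine ⟨by simp only; omega, by simp only; omega, ?_⟩
        rcases h₃ with h₃ | h₃ | h₃ | ⟨i', l', h₃, h₄, h₅⟩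
        · exact Or.inl (by simp only; omega)
        · exact Or.inr (Or.inl (by simp only; omega))
        · exact Or.inr (Or.inr (Or.inl (by simp only; omega)))
        · exact Or.inr (Or.inr (Or.inr ⟨i', l', h₃, by simp only; omega, by simp only; omega⟩))
  have h : IsPathTriple m n a b p q r :=
    { one_le_a := ha
      a_le := ham
      one_le_b := hb
      b_le := hbn
      lt_or_lt := hab
      p_step := p_step
      q_step := q_step
      r_step := r_step
      p_start := p_mem (1, 1) (by simp [mem₁])
      p_end := p_mem (a, n) (by simp [mem₁])
      q_start := q_mem (2, 1) (by simp [mem₂])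
      q_end := q_mem (m, b) (by simp [mem₂])
      r_start := r_mem (a, b) (by simp [mem₃])
      r_end := r_mem (m, n) (by simp [mem₃])
      p_lt_q := fun s hs _ _ => by
        obtain ⟨x, hx, ex⟩ := hp s
        obtain ⟨y, hy, ey⟩ := hq s
        have := hsep x hx y hy
        have : 1 ≤ y.1 := by
          rcases (mem₂ y).1 hy with rfl | rfl | ⟨hy, -⟩
          · simp
          · simp only
            omega
          · exact (grid hy).1
        omega }
  refine ⟨p, q, r, h, ?_⟩
  rintro ⟨c, i, j⟩ hv
  have := grid hv
  cases c
  · rw [h.mem_false]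
    by_cases hPv : P (i, j)
    · right
      have h₁ := hPv.1
      have h₂ := hPv.2.1
      simp only at h₁ h₂
      exact ⟨by omega, by omega, q_mem (i, j) ((mem₂ _).2 (Or.inr (Or.inr ⟨hv, hPv⟩)))⟩
    · left
      have := row_le hv hPv
      exact ⟨by omega, by omega, p_mem (i, j) ((mem₁ _).2 (Or.inr (Or.inr ⟨hv, hPv⟩)))⟩
  · rw [h.mem_true]
    have := hX _ _ hv
    exact ⟨by omega, by omega, r_mem (i, j) ((mem₃ _).2 (Or.inr (Or.inr hv)))⟩

/-- If `x_{a,b}` is the north-west-most vertex of the `X`-part of a face, then the face lies in a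
path triple starting at `(a,b)`. -/
theorem IsFace.exists_triple_of_mem {m n a b : ℕ} {F : Finset V} (hF : IsFace m n F)
    (hm : 2 ≤ m) (hn : 2 ≤ n) (hab : a < m ∨ b < n) (hmem : (true, a, b) ∈ F)
    (hX : ∀ i j, (true, i, j) ∈ F → a ≤ i ∧ b ≤ j) :
    ∃ p q r, IsPathTriple m n a b p q r ∧ F ⊆ tripleSet m n a b p q r := by
  obtain ⟨ha, ham, hb, hbn⟩ := hF.1 _ hmem
  simp only at ha ham hb hbn
  refine hF.exists_triple hm hn ha ham hb hbn hab hX ?_ ?_ ?_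
  · intro i j h
    by_contra hij
    exact hF.2.2.1 a i b j (by omega) (by omega) ⟨hmem, h⟩
  · intro i j k l h₁ h₂ hij hja hbk
    by_contra hlk
    exact hF.2.2.2.1 i j a b k l hij hja hbk (by omega) ⟨hmem, h₂, h₁⟩
  · intro i j k l h₁ h₂ hij hai hlb
    by_contra hlk
    exact hF.2.2.2.2.1 a i j k l b hai hij (by omega) hlb ⟨hmem, h₁, h₂⟩

/-- A face whose `X`-part is contained in `{x_{m,n}}` lies in a path triple starting at
`(m,n-1)`. -/
theorem IsFace.exists_triple_of_forall_eq {m n : ℕ} {F : Finset V} (hF : IsFace m n F)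
    (hm : 2 ≤ m) (hn : 2 ≤ n) (hX : ∀ i j, (true, i, j) ∈ F → i = m ∧ j = n) :
    ∃ p q r, IsPathTriple m n m (n - 1) p q r ∧ F ⊆ tripleSet m n m (n - 1) p q r := by
  refine hF.exists_triple hm hn (by omega) le_rfl (by omega) (by omega) (by omega) ?_ ?_ ?_ ?_
  · intro i j h
    have := hX i j h
    omega
  · intro i j h
    exact Or.inl (hF.1 _ h).2.1
  · intro i j k l h₁ h₂ hij hja hbk
    have := (hF.1 _ h₁).2.2.2
    simp only at this
    omega
  · intro i j k l h₁ h₂ hij hai hlb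
    have := (hF.1 _ h₁).2.1
    simp only at this
    omega

theorem IsFace.exists_triple_superset {m n : ℕ} {F : Finset V} (hF : IsFace m n F)
    (hm : 2 ≤ m) (hn : 2 ≤ n) :
    ∃ a b p q r, IsPathTriple m n a b p q r ∧ F ⊆ tripleSet m n a b p q r := by
  by_cases hX : ∀ i j, (true, i, j) ∈ F → i = m ∧ j = n
  · exact ⟨_, _, hF.exists_triple_of_forall_eq hm hn hX⟩
  · push Not at hX
    obtain ⟨i₀, j₀, h₀, hne⟩ := hX
    obtain ⟨⟨c, a, b⟩, hab, hmin⟩ := Finset.exists_min_image (F.filter fun v => v.1 = true)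
      (fun v => v.2.1 + v.2.2) ⟨_, Finset.mem_filter.2 ⟨h₀, rfl⟩⟩
    simp only [Finset.mem_filter] at hab hmin
    obtain ⟨hab, rfl⟩ := hab
    have hle : ∀ i j, (true, i, j) ∈ F → a ≤ i ∧ b ≤ j := by
      intro i j h
      have := hmin _ ⟨h, rfl⟩
      have h₁ : ¬ (i < a ∧ b < j) := fun hlt => hF.2.1 i a b j hlt.1 hlt.2 ⟨h, hab⟩
      have h₂ : ¬ (a < i ∧ j < b) := fun hlt => hF.2.1 a i j b hlt.1 hlt.2 ⟨hab, h⟩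
      simp only at this
      omega
    have := hF.1 _ h₀
    have := hle _ _ h₀
    rw [InGrid] at *
    exact ⟨a, b, hF.exists_triple_of_mem hm hn (by simp only at *; omega) hab hle⟩

theorem isFacet_iff {m n : ℕ} (hm : 2 ≤ m) (hn : 2 ≤ n) {F : Finset V} :
    IsFacet m n F ↔ ∃ a b p q r, IsPathTriple m n a b p q r ∧ F = tripleSet m n a b p q r := by
  constructor
  · rintro ⟨hF, hmax⟩
    obtain ⟨a, b, p, q, r, h, hsub⟩ := hF.exists_triple_superset hm hn
    exact ⟨a, b, p, q, r, h, hmax _ h.isFace hsub⟩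
  · rintro ⟨a, b, p, q, r, h, rfl⟩
    refine ⟨h.isFace, fun G hG hsub => ?_⟩
    obtain ⟨a', b', p', q', r', h_other, hsub'⟩ := hG.exists_triple_superset hm hn
    refine Finset.eq_of_subset_of_card_le hsub ?_
    rw [h.card_eq hm hn, ← h_other.card_eq hm hn]
    exact Finset.card_le_card hsub'

/-- A statistic which decreases when the first vertex `x_{a,b}` of the `X`-part of a facet moves
south-east, with `x_{m,n-1}` before `x_{m-1,n}`. -/
def startRank (m n : ℕ) (F : Finset V) : ℕ :=
  F.sup fun v => if v.1 then
    2 * (m + n - (v.2.1 + v.2.2)) + (if v.2.1 = m ∧ v.2.2 + 1 = n then 0 else 1) else 0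

/-- Facets are ordered by the starting point of their `X`-part, then by decreasing sum of the row
indices of their vertices. -/
def shellingKey (m n : ℕ) (F : Finset V) : ℕ ×ₗ ℤ :=
  toLex (startRank m n F, -((∑ v ∈ F, v.2.1 : ℕ) : ℤ))

namespace IsPathTriple

variable {m n a b : ℕ} {p q r p' q' r' : ℕ → ℕ}

theorem start_mem (h : IsPathTriple m n a b p q r) :
    (true, a, b) ∈ tripleSet m n a b p q r := by
  have := h.a_le
  have := h.b_le
  exact h.mem_true.2 ⟨le_rfl, by omega, h.r_start⟩

theorem startRank_eq (h : IsPathTriple m n a b p q r) :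
    startRank m n (tripleSet m n a b p q r) =
      2 * (m + n - (a + b)) + (if a = m ∧ b + 1 = n then 0 else 1) := by
  refine le_antisymm (Finset.sup_le ?_) ?_
  · rintro ⟨c, i, j⟩ hv
    cases c
    · simp
    · have := h.bounds_true hv
      simp only [if_true]
      split_ifs <;> omega
  · exact Finset.le_sup (f := fun v : V => if v.1 then
      2 * (m + n - (v.2.1 + v.2.2)) + (if v.2.1 = m ∧ v.2.2 + 1 = n then 0 else 1) else 0)
      h.start_mem

theorem eq_of_le (h : IsPathTriple m n a b p q r) (h_other : IsPathTriple m n a b p' q' r')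
    (hp : ∀ s ∈ Finset.Icc 2 (a + n), p s ≤ p' s) (hq : ∀ s ∈ Finset.Icc 3 (m + b), q s ≤ q' s)
    (hr : ∀ s ∈ Finset.Icc (a + b) (m + n), r s ≤ r' s)
    (hsum : ∑ v ∈ tripleSet m n a b p' q' r', v.2.1 ≤ ∑ v ∈ tripleSet m n a b p q r, v.2.1) :
    tripleSet m n a b p q r = tripleSet m n a b p' q' r' := by
  rw [h.sum_eq, h_other.sum_eq] at hsum
  simp only at hsum
  have ep := Finset.sum_le_sum hp
  have eq := Finset.sum_le_sum hq
  have er := Finset.sum_le_sum hr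
  have ep := (Finset.sum_eq_sum_iff_of_le hp).1 (by omega)
  have eq := (Finset.sum_eq_sum_iff_of_le hq).1 (by omega)
  have er := (Finset.sum_eq_sum_iff_of_le hr).1 (by omega)
  have congr : ∀ {c : Bool} {ρ ρ' : ℕ → ℕ} {s t : ℕ}, (∀ u ∈ Finset.Icc s t, ρ u = ρ' u) →
      pathSet c ρ s t = pathSet c ρ' s t := fun e =>
    Finset.image_congr fun u hu => by simp only [e u (Finset.mem_coe.1 hu)]
  rw [tripleSet, tripleSet, congr ep, congr eq, congr er]

theorem exchange_of_le (h : IsPathTriple m n a b p q r) (h_other : IsPathTriple m n a b p' q' r')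
    (hm : 2 ≤ m) (hn : 2 ≤ n) (hp : ∀ s, p s ≤ p' s) (hq : ∀ s, q s ≤ q' s)
    (hr : ∀ s, r s ≤ r' s) {v : V} (hv : v ∈ tripleSet m n a b p q r)
    (hv' : v ∉ tripleSet m n a b p' q' r')
    (hsub : ∀ w ∈ tripleSet m n a b p q r, w ≠ v → w ∈ tripleSet m n a b p' q' r') :
    ∃ F', IsFacet m n F' ∧ shellingKey m n F' < shellingKey m n (tripleSet m n a b p q r) ∧
      tripleSet m n a b p q r \ F' = {v} := by
  refine ⟨_, (isFacet_iff hm hn).2 ⟨_, _, _, _, _, h_other, rfl⟩, ?_, ?_⟩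
  · rw [shellingKey, shellingKey, Prod.Lex.toLex_lt_toLex, h.startRank_eq, h_other.startRank_eq]
    refine Or.inr ⟨rfl, ?_⟩
    by_contra hlt
    refine hv' (h.eq_of_le h_other (fun s _ => hp s) (fun s _ => hq s) (fun s _ => hr s) ?_ ▸ hv)
    simp only at hlt
    omega
  · ext w
    simp only [Finset.mem_sdiff, Finset.mem_singleton]
    constructor
    · rintro ⟨h₁, h₂⟩
      by_contra hne
      exact h₂ (hsub w h₁ hne)
    · rintro rfl
      exact ⟨hv, hv'⟩

theorem update_r (h : IsPathTriple m n a b p q r) {w : ℕ} (hw : a + b ≤ w) (hw' : w + 2 ≤ m + n)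
    (h₁ : r (w + 1) = r w) (h₂ : r (w + 2) = r w + 1) :
    IsPathTriple m n a b p q (Function.update r (w + 1) (r (w + 1) + 1)) :=
  { h with
    r_step := h.r_step.update h₁ h₂
    r_start := by rw [Function.update_of_ne (by omega), h.r_start]
    r_end := by rw [Function.update_of_ne (by omega), h.r_end] }

theorem update_q (h : IsPathTriple m n a b p q r) {w : ℕ} (hw : 3 ≤ w) (hw' : w + 2 ≤ m + b)
    (h₁ : q (w + 1) = q w) (h₂ : q (w + 2) = q w + 1) :
    IsPathTriple m n a b p (Function.update q (w + 1) (q (w + 1) + 1)) r :=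
  { h with
    q_step := h.q_step.update h₁ h₂
    q_start := by rw [Function.update_of_ne (by omega), h.q_start]
    q_end := by rw [Function.update_of_ne (by omega), h.q_end]
    p_lt_q := fun s hs hs₁ hs₂ => by
      have := h.p_lt_q s hs hs₁ hs₂
      rw [Function.update_apply]
      split_ifs with e
      · subst e
        omega
      · exact this }

theorem update_p (h : IsPathTriple m n a b p q r) {w : ℕ} (hw : 2 ≤ w) (hw' : w + 2 ≤ a + n)
    (h₁ : p (w + 1) = p w) (h₂ : p (w + 2) = p w + 1)
    (hlt : w + 1 ≤ m + b → p (w + 1) + 1 < q (w + 1)) :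
    IsPathTriple m n a b (Function.update p (w + 1) (p (w + 1) + 1)) q r :=
  { h with
    p_step := h.p_step.update h₁ h₂
    p_start := by rw [Function.update_of_ne (by omega), h.p_start]
    p_end := by rw [Function.update_of_ne (by omega), h.p_end]
    p_lt_q := fun s hs hs₁ hs₂ => by
      have := h.p_lt_q s hs hs₁ hs₂
      rw [Function.update_apply]
      split_ifs with e
      · subst e
        exact hlt hs₂
      · exact this }

/-- An exchange at the corner `w + 1` of the path `r`. -/
theorem exchange_r (h : IsPathTriple m n a b p q r) (hm : 2 ≤ m) (hn : 2 ≤ n) {w : ℕ}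
    (hw : a + b ≤ w) (hw' : w + 2 ≤ m + n) (h₁ : r (w + 1) = r w) (h₂ : r (w + 2) = r w + 1) :
    ∃ F', IsFacet m n F' ∧ shellingKey m n F' < shellingKey m n (tripleSet m n a b p q r) ∧
      tripleSet m n a b p q r \ F' = {(true, r (w + 1), w + 1 - r (w + 1))} := by
  have h_other := h.update_r hw hw' h₁ h₂
  have := h.r_step.le_and_le hw
  have := h.r_start
  have e : r (w + 1) + (w + 1 - r (w + 1)) = w + 1 := by omega
  refine h.exchange_of_le h_other hm hn (fun _ => le_rfl) (fun _ => le_rfl) (fun s => ?_) ?_ ?_ ?_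
  · rw [Function.update_apply]
    split_ifs with hs
    · simp [hs]
    · rfl
  · rw [h.mem_true, e]
    omega
  · rw [h_other.mem_true, e, Function.update_self]
    omega
  · rintro ⟨c, i, j⟩ hv hne
    cases c
    · rw [h.mem_false] at hv
      rwa [h_other.mem_false]
    · rw [h.mem_true] at hv
      rw [h_other.mem_true, Function.update_of_ne]
      · exact hv
      · intro hij
        rw [hij] at hv
        exact hne (by rw [hv.2.2, ← hij]; simp)

/-- An exchange at the corner `w + 1` of the path `q`. -/
theorem exchange_q (h : IsPathTriple m n a b p q r) (hm : 2 ≤ m) (hn : 2 ≤ n) {w : ℕ}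
    (hw : 3 ≤ w) (hw' : w + 2 ≤ m + b) (h₁ : q (w + 1) = q w) (h₂ : q (w + 2) = q w + 1) :
    ∃ F', IsFacet m n F' ∧ shellingKey m n F' < shellingKey m n (tripleSet m n a b p q r) ∧
      tripleSet m n a b p q r \ F' = {(false, q (w + 1), w + 1 - q (w + 1))} := by
  have h_other := h.update_q hw hw' h₁ h₂
  have := h.bounds_q (s := w + 1) (by omega) (by omega)
  have hlt := h.p_lt_q (w + 1) (by omega)
  have e : q (w + 1) + (w + 1 - q (w + 1)) = w + 1 := by omega
  refine h.exchange_of_le h_other hm hn (fun _ => le_rfl) (fun s => ?_) (fun _ => le_rfl) ?_ ?_ ?_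
  · rw [Function.update_apply]
    split_ifs with hs
    · simp [hs]
    · rfl
  · rw [h.mem_false, e]
    omega
  · rw [h_other.mem_false, e, Function.update_self]
    omega
  · rintro ⟨c, i, j⟩ hv hne
    cases c
    · rw [h.mem_false] at hv
      rw [h_other.mem_false]
      refine hv.imp_right fun hv => ?_
      rw [Function.update_of_ne]
      · exact hv
      · intro hij
        rw [hij] at hv
        exact hne (by rw [hv.2.2, ← hij]; simp)
    · rw [h.mem_true] at hv
      rwa [h_other.mem_true]

/-- An exchange at the corner `w + 1` of the path `p`. If the flipped corner lies on `q`, then it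
is a corner of `q`, which is flipped as well. -/
theorem exchange_p (h : IsPathTriple m n a b p q r) (hm : 2 ≤ m) (hn : 2 ≤ n) {w : ℕ}
    (hw : 2 ≤ w) (hw' : w + 2 ≤ a + n) (h₁ : p (w + 1) = p w) (h₂ : p (w + 2) = p w + 1)
    (hq : w + 1 ≤ m + b → q (w + 1) = p (w + 1) + 1 → 3 ≤ w ∧ w + 2 ≤ m + b) :
    ∃ F', IsFacet m n F' ∧ shellingKey m n F' < shellingKey m n (tripleSet m n a b p q r) ∧
      tripleSet m n a b p q r \ F' = {(false, p (w + 1), w + 1 - p (w + 1))} := by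
  have := h.bounds_p (s := w + 1) (by omega) (by omega)
  have hlt := h.p_lt_q (w + 1) (by omega) (by omega)
  have e : p (w + 1) + (w + 1 - p (w + 1)) = w + 1 := by omega
  have hle : ∀ (ρ : ℕ → ℕ) s, ρ s ≤ Function.update ρ (w + 1) (ρ (w + 1) + 1) s := by
    intro ρ s
    rw [Function.update_apply]
    split_ifs with hs
    · simp [hs]
    · rfl
  by_cases hblock : w + 1 ≤ m + b ∧ q (w + 1) = p (w + 1) + 1
  · obtain ⟨hw₃, hwq⟩ := hq hblock.1 hblock.2
    have := h.p_lt_q w hw₃ (by omega) (by omega)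
    have := h.p_lt_q (w + 2) (by omega) (by omega) (by omega)
    have := h.q_step w
    have : q (w + 1) ≤ q (w + 2) ∧ q (w + 2) ≤ q (w + 1) + 1 := h.q_step (w + 1)
    have h_other := (h.update_q hw₃ hwq (by omega) (by omega)).update_p hw hw' h₁ h₂ fun _ => by
      rw [Function.update_self]
      omega
    refine h.exchange_of_le h_other hm hn (hle p) (hle q) (fun _ => le_rfl) ?_ ?_ ?_
    · rw [h.mem_false, e]
      omega
    · rw [h_other.mem_false, e, Function.update_self, Function.update_self]
      omega
    · rintro ⟨c, i, j⟩ hv hne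
      cases c
      · rw [h.mem_false] at hv
        rw [h_other.mem_false]
        by_cases hij : i + j = w + 1
        · rw [hij] at hv ⊢
          rw [Function.update_self]
          rcases hv with hv | hv
          · exact absurd (by rw [hv.2.2, ← hij]; simp) hne
          · omega
        · rwa [Function.update_of_ne hij, Function.update_of_ne hij]
      · rw [h.mem_true] at hv
        rwa [h_other.mem_true]
  · have h_other := h.update_p hw hw' h₁ h₂ (by omega)
    refine h.exchange_of_le h_other hm hn (hle p) (fun _ => le_rfl) (fun _ => le_rfl) ?_ ?_ ?_
    · rw [h.mem_false, e]
      omega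
    · rw [h_other.mem_false, e, Function.update_self]
      omega
    · rintro ⟨c, i, j⟩ hv hne
      cases c
      · rw [h.mem_false] at hv
        rw [h_other.mem_false]
        refine hv.imp_left fun hv => ?_
        rw [Function.update_of_ne]
        · exact hv
        · intro hij
          rw [hij] at hv
          exact hne (by rw [hv.2.2, ← hij]; simp)
      · rw [h.mem_true] at hv
        rwa [h_other.mem_true]

/-- An exchange at the starting point of the path `r`. -/
theorem exchange_start (h : IsPathTriple m n a b p q r) (hm : 2 ≤ m) (hn : 2 ≤ n)
    (hab : ¬ (a = m ∧ b + 1 = n)) :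
    ∃ F', IsFacet m n F' ∧ shellingKey m n F' < shellingKey m n (tripleSet m n a b p q r) ∧
      tripleSet m n a b p q r \ F' = {(true, a, b)} := by
  have ha := h.a_le
  have hb := h.b_le
  have hlt := h.lt_or_lt
  have hstep := h.r_step (a + b)
  have hstart := h.r_start
  have hface : IsFace m n ((tripleSet m n a b p q r).erase (true, a, b)) := by
    obtain ⟨h₀, hA, hB, hC, hD, hE⟩ := h.isFace
    have sub : ∀ {v}, v ∈ (tripleSet m n a b p q r).erase (true, a, b) →
        v ∈ tripleSet m n a b p q r := Finset.mem_of_mem_erase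
    exact ⟨fun v hv => h₀ v (sub hv),
      fun i j k l hi hk hv => hA i j k l hi hk ⟨sub hv.1, sub hv.2⟩,
      fun i j k l hi hk hv => hB i j k l hi hk ⟨sub hv.1, sub hv.2⟩,
      fun i j k x y z hi hj hx hy hv =>
        hC i j k x y z hi hj hx hy ⟨sub hv.1, sub hv.2.1, sub hv.2.2⟩,
      fun i j k x y z hi hj hx hy hv =>
        hD i j k x y z hi hj hx hy ⟨sub hv.1, sub hv.2.1, sub hv.2.2⟩,
      fun i j k x y z hi hj hx hy hv =>
        hE i j k x y z hi hj hx hy ⟨sub hv.1, sub hv.2.1, sub hv.2.2⟩⟩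
  have hgt : ∀ i j, (true, i, j) ∈ (tripleSet m n a b p q r).erase (true, a, b) →
      r (a + b + 1) ≤ i ∧ a + b + 1 - r (a + b + 1) ≤ j := by
    intro i j hv
    rw [Finset.mem_erase, h.mem_true] at hv
    obtain ⟨hne, hv₁, hv₂, hv₃⟩ := hv
    have : i + j ≠ a + b := by
      intro hij
      rw [hij, hstart] at hv₃
      subst hv₃
      exact hne (by rw [show j = b by omega])
    have := h.r_step.le_and_le (show a + b + 1 ≤ i + j by omega)
    omega
  have conclude : ∀ {a' b' p' q' r'}, IsPathTriple m n a' b' p' q' r' →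
      (tripleSet m n a b p q r).erase (true, a, b) ⊆ tripleSet m n a' b' p' q' r' →
      ¬ (a' ≤ a ∧ b' ≤ b) →
      2 * (m + n - (a' + b')) + (if a' = m ∧ b' + 1 = n then 0 else 1) <
        2 * (m + n - (a + b)) + (if a = m ∧ b + 1 = n then 0 else 1) →
      ∃ F', IsFacet m n F' ∧ shellingKey m n F' < shellingKey m n (tripleSet m n a b p q r) ∧
        tripleSet m n a b p q r \ F' = {(true, a, b)} := by
    intro a' b' p' q' r' h_other hsub hnot hrank
    refine ⟨_, (isFacet_iff hm hn).2 ⟨_, _, _, _, _, h_other, rfl⟩, ?_, ?_⟩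
    · rw [shellingKey, shellingKey, Prod.Lex.toLex_lt_toLex, h.startRank_eq, h_other.startRank_eq]
      exact Or.inl hrank
    · ext w
      simp only [Finset.mem_sdiff, Finset.mem_singleton]
      constructor
      · rintro ⟨h₁, h₂⟩
        by_contra hne
        exact h₂ (hsub (Finset.mem_erase.2 ⟨hne, h₁⟩))
      · rintro rfl
        refine ⟨h.start_mem, fun hmem => hnot ?_⟩
        have := h_other.bounds_true hmem
        omega
  by_cases hlast : a + b + 1 = m + n
  · obtain ⟨p', q', r', h_other, hsub⟩ := hface.exists_triple_of_forall_eq hm hn fun i j hv => by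
      have hgt := hgt i j hv
      obtain ⟨h₁, h₂, h₃, h₄⟩ := hface.1 _ hv
      rw [hlast, h.r_end] at hgt
      simp only at h₂ h₄
      omega
    refine conclude h_other hsub (by omega) ?_
    split_ifs <;> omega
  · have hend := h.r_step.le_and_le (show a + b + 1 ≤ m + n by omega)
    rw [h.r_end] at hend
    have hmem : (true, r (a + b + 1), a + b + 1 - r (a + b + 1)) ∈
        (tripleSet m n a b p q r).erase (true, a, b) := by
      have e : r (a + b + 1) + (a + b + 1 - r (a + b + 1)) = a + b + 1 := by omega
      rw [Finset.mem_erase, h.mem_true, e]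
      refine ⟨fun hne => ?_, by omega, by omega, rfl⟩
      simp only [Prod.mk.injEq] at hne
      omega
    obtain ⟨p', q', r', h_other, hsub⟩ := hface.exists_triple_of_mem hm hn (by omega) hmem hgt
    refine conclude h_other hsub (by omega) ?_
    split_ifs <;> omega

end IsPathTriple

theorem IsFacet.exists_exchange {m n : ℕ} (hm : 2 ≤ m) (hn : 2 ≤ n) {F G : Finset V}
    (hF : IsFacet m n F) (hG : IsFacet m n G) (hne : G ≠ F)
    (hkey : shellingKey m n G ≤ shellingKey m n F) :
    ∃ v ∈ F \ G, ∃ F', IsFacet m n F' ∧ shellingKey m n F' < shellingKey m n F ∧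
      F \ F' = {v} := by
  obtain ⟨a, b, p, q, r, h, rfl⟩ := (isFacet_iff hm hn).1 hF
  obtain ⟨a', b', p', q', r', h_other, rfl⟩ := (isFacet_iff hm hn).1 hG
  rw [shellingKey, shellingKey, Prod.Lex.toLex_le_toLex, h.startRank_eq, h_other.startRank_eq] at hkey
  simp only at hkey
  have := h.a_le
  have := h.b_le
  have := h.lt_or_lt
  have := h_other.a_le
  have := h_other.b_le
  have := h_other.lt_or_lt
  by_cases hstart : ¬ (a = m ∧ b + 1 = n) ∧ (true, a, b) ∉ tripleSet m n a' b' p' q' r'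
  · exact ⟨_, Finset.mem_sdiff.2 ⟨h.start_mem, hstart.2⟩, h.exchange_start hm hn hstart.1⟩
  obtain ⟨rfl, rfl⟩ : a = a' ∧ b = b' := by
    by_cases hab : a = m ∧ b + 1 = n
    · rw [if_pos hab] at hkey
      split_ifs at hkey <;> omega
    · rw [if_neg hab] at hkey
      have := h_other.bounds_true (not_not.1 (not_and.1 hstart hab))
      split_ifs at hkey <;> omega
  clear hstart
  by_cases hp : ∃ s ∈ Finset.Icc 2 (a + n), p s < p' s
  · obtain ⟨s, hs, hlt⟩ := hp
    rw [Finset.mem_Icc] at hs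
    obtain ⟨w, hw, hw', h₁, h₂, h₃⟩ := h.p_step.exists_corner h_other.p_step
      (h_other.p_start.trans h.p_start.symm) (h_other.p_end.trans h.p_end.symm) hs.1 hs.2 hlt
    have := h_other.p_lt_q (w + 1) (by omega) (by omega)
    have := h.bounds_p (s := w + 1) (by omega) (by omega)
    have e : p (w + 1) + (w + 1 - p (w + 1)) = w + 1 := by omega
    refine ⟨_, Finset.mem_sdiff.2 ⟨?_, ?_⟩, h.exchange_p hm hn hw hw' h₁ h₂ fun hwb hq => ?_⟩
    · rw [h.mem_false, e]
      omega
    · rw [h_other.mem_false, e]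
      omega
    · constructor
      · by_contra hw₃
        obtain rfl : w = 2 := by omega
        have := h.q_start
        have := h_other.q_start
        simp only [Nat.reduceAdd] at *
        omega
      · by_contra hwb'
        have e : w + 1 = m + b := by omega
        have h₄ := h.q_end
        have h₅ := h_other.q_end
        rw [← e] at h₄ h₅
        omega
  push Not at hp
  by_cases hq : ∃ s ∈ Finset.Icc 3 (m + b), q s < q' s
  · obtain ⟨s, hs, hlt⟩ := hq
    rw [Finset.mem_Icc] at hs
    obtain ⟨w, hw, hw', h₁, h₂, h₃⟩ := h.q_step.exists_corner h_other.q_step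
      (h_other.q_start.trans h.q_start.symm) (h_other.q_end.trans h.q_end.symm) hs.1 hs.2 hlt
    have := h.p_lt_q (w + 1) (by omega)
    have := hp (w + 1)
    rw [Finset.mem_Icc] at this
    have := h.bounds_q (s := w + 1) (by omega) (by omega)
    have e : q (w + 1) + (w + 1 - q (w + 1)) = w + 1 := by omega
    refine ⟨_, Finset.mem_sdiff.2 ⟨?_, ?_⟩, h.exchange_q hm hn hw hw' h₁ h₂⟩
    · rw [h.mem_false, e]
      omega
    · rw [h_other.mem_false, e]
      omega
  push Not at hq
  by_cases hr : ∃ s ∈ Finset.Icc (a + b) (m + n), r s < r' s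
  · obtain ⟨s, hs, hlt⟩ := hr
    rw [Finset.mem_Icc] at hs
    obtain ⟨w, hw, hw', h₁, h₂, h₃⟩ := h.r_step.exists_corner h_other.r_step
      (h_other.r_start.trans h.r_start.symm) (h_other.r_end.trans h.r_end.symm) hs.1 hs.2 hlt
    have := h.r_step.le_and_le hw
    have := h.r_start
    have e : r (w + 1) + (w + 1 - r (w + 1)) = w + 1 := by omega
    refine ⟨_, Finset.mem_sdiff.2 ⟨?_, ?_⟩, h.exchange_r hm hn hw hw' h₁ h₂⟩
    · rw [h.mem_true, e]
      omega
    · rw [h_other.mem_true, e]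
      omega
  push Not at hr
  exact absurd (h_other.eq_of_le h hp hq hr (by omega)) hne

theorem finite_setOf_isFacet (m n : ℕ) : {F | IsFacet m n F}.Finite := by
  refine (Finset.finite_toSet
    ((Finset.univ ×ˢ Finset.Icc 1 m ×ˢ Finset.Icc 1 n : Finset V).powerset)).subset fun F hF => ?_
  rw [Finset.mem_coe, Finset.mem_powerset]
  intro v hv
  have := hF.1.1 v hv
  rw [InGrid] at this
  simp only [Finset.mem_product, Finset.mem_univ, Finset.mem_Icc, true_and]
  omega

theorem complex_is_shellable (m n : ℕ) (hm : 2 ≤ m) (hmn : m ≤ n) :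
    ∃ (e : ℕ) (f : Fin e → Finset V),
      Function.Injective f ∧
      (∀ G : Finset V, IsFacet m n G ↔ ∃ i, f i = G) ∧
      (∀ i j : Fin e, j < i →
        ∃ v ∈ f i \ f j, ∃ k : Fin e, k < i ∧ f i \ f k = {v}) := by
  have := (finite_setOf_isFacet m n).to_subtype
  let E := (Finite.equivFin {F | IsFacet m n F}).symm
  let σ := Tuple.sort fun i => shellingKey m n (E i)
  have hmono : Monotone fun i => shellingKey m n (E (σ i)) :=
    Tuple.monotone_sort fun i => shellingKey m n (E i)
  have hinj : Function.Injective fun i => (E (σ i) : Finset V) :=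
    Subtype.val_injective.comp (E.injective.comp σ.injective)
  have hsurj : ∀ G, IsFacet m n G → ∃ i, (E (σ i) : Finset V) = G := fun G hG =>
    ⟨(σ.trans E).symm ⟨G, hG⟩,
      congrArg Subtype.val ((σ.trans E).apply_symm_apply ⟨G, hG⟩)⟩
  refine ⟨_, fun i => E (σ i), hinj, fun G => ⟨hsurj G, ?_⟩, fun i j hji => ?_⟩
  · rintro ⟨i, rfl⟩
    exact (E (σ i)).2
  · obtain ⟨v, hv, F', hF', hlt, hsdiff⟩ := IsFacet.exists_exchange hm (hm.trans hmn)
      (E (σ i)).2 (E (σ j)).2 (fun h => hji.ne (hinj h)) (hmono hji.le)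
    obtain ⟨k, rfl⟩ := hsurj F' hF'
    exact ⟨v, hv, k, hmono.reflect_lt hlt, hsdiff⟩
end
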